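/- arXiv:math/0607555 — 5 statements merged into one kernel-verified Lean document; each statement's English description precedes it below -/
import Mathlib

section
/- Let p ≤ P be integers such that every integer eigenvalue of a₋₁ is ≥ −P. Suppose there exist n×n matrices c_p, …, c_P with c_p ≠ 0 satisfying c_{k+1}((k+1)I_n + a₋₁) = −Σ_{j=0}^{k−p} c_{k−j} a_j for every integer k with p−1 ≤ k ≤ P−1 (for k = p−1 the right-hand side is the empty sum, i.e. c_p (p I_n + a₋₁) = 0). Then the adjoint system dY/dx = −Y A(x) has a solution Y(x) = Σ_{k≥p} c̃_k (x − x₀)^k on D with c̃_k = c_k for p ≤ k ≤ P and c̃_p = c_p ≠ 0. -/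
/-- A sequence bounded against a geometric weight `t` is summable against any smaller weight,
even after multiplication by a power of the index. -/
theorem summable_pow_mul_geometric_mul_norm {E : Type*} [SeminormedAddCommGroup E]
    {d : ℕ → E} {C s t : ℝ} (hs : 0 < s) (hst : s < t) (hC : ∀ k, t ^ k * ‖d k‖ ≤ C) (i : ℕ) :
    Summable fun k : ℕ => (k : ℝ) ^ i * s ^ k * ‖d k‖ := by
  have ht : 0 < t := hs.trans hst
  have hq : ‖s / t‖ < 1 := by
    rw [Real.norm_of_nonneg (by positivity)]
    exact (div_lt_one ht).2 hst
  refine Summable.of_nonneg_of_le (fun k => by positivity) (fun k => ?_)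
    ((summable_pow_mul_geometric_of_norm_lt_one i hq).mul_right C)
  calc (k : ℝ) ^ i * s ^ k * ‖d k‖ = (k : ℝ) ^ i * (s / t) ^ k * (t ^ k * ‖d k‖) := by
        rw [div_pow]; field_simp
    _ ≤ (k : ℝ) ^ i * (s / t) ^ k * C := by gcongr; exact hC k

theorem exists_pow_mul_norm_le_of_summable {E : Type*} [NormedAddCommGroup E]
    [NormedSpace ℂ E] {a : ℕ → E} {r : ℝ} (hr : 0 ≤ r)
    (ha : Summable fun k : ℕ => (r : ℂ) ^ k • a k) : ∃ M, ∀ k, r ^ k * ‖a k‖ ≤ M := by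
  obtain ⟨M, hM⟩ := ha.tendsto_atTop_zero.norm.bddAbove_range
  refine ⟨M, fun k => ?_⟩
  have := hM ⟨k, rfl⟩
  simpa [norm_smul, abs_of_nonneg hr] using this

section FrobeniusRecurrence

variable {𝔸 : Type*} [NormedRing 𝔸] [NormedAlgebra ℂ 𝔸]

/-- Coefficients satisfying the Frobenius recurrence have at least the radius of convergence
of the coefficient function. -/
theorem exists_pow_mul_norm_le_of_recurrence {b : 𝔸} {a d : ℕ → 𝔸} {p : ℤ} {M r s : ℝ}
    (hs : 0 < s) (hsr : s < r) (hM : ∀ k, r ^ k * ‖a k‖ ≤ M)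
    (hrec : ∀ m : ℕ, d (m + 1) * (((p + m + 1 : ℤ) : ℂ) • (1 : 𝔸) + b)
      = -∑ j ∈ Finset.range (m + 1), d (m - j) * a j) :
    ∃ C, ∀ k, s ^ k * ‖d k‖ ≤ C := by
  have hr : 0 < r := hs.trans hsr
  set S : ℕ → ℝ := fun m => ∑ i ∈ Finset.range (m + 1), r ^ i * ‖d i‖ with hS
  have hS0 : ∀ m, 0 ≤ S m := fun m => Finset.sum_nonneg fun i _ => by positivity
  have key : ∀ m : ℕ, (|((p + m + 1 : ℤ) : ℝ)| - ‖b‖) * (r ^ (m + 1) * ‖d (m + 1)‖)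
      ≤ r * M * S m := by
    intro m
    have h1 : (|((p + m + 1 : ℤ) : ℝ)| - ‖b‖) * ‖d (m + 1)‖
        ≤ ∑ j ∈ Finset.range (m + 1), ‖d (m - j)‖ * ‖a j‖ := by
      calc (|((p + m + 1 : ℤ) : ℝ)| - ‖b‖) * ‖d (m + 1)‖
          ≤ ‖((p + m + 1 : ℤ) : ℂ) • d (m + 1)‖ - ‖d (m + 1) * b‖ := by
            rw [norm_smul, Complex.norm_intCast]
            nlinarith [norm_mul_le (d (m + 1)) b]
        _ ≤ ‖d (m + 1) * (((p + m + 1 : ℤ) : ℂ) • (1 : 𝔸) + b)‖ := by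
            rw [mul_add, mul_smul_comm, mul_one]
            exact norm_sub_le_norm_add _ _
        _ ≤ ∑ j ∈ Finset.range (m + 1), ‖d (m - j)‖ * ‖a j‖ := by
            rw [hrec, norm_neg]
            exact (norm_sum_le _ _).trans (Finset.sum_le_sum fun j _ => norm_mul_le _ _)
    calc (|((p + m + 1 : ℤ) : ℝ)| - ‖b‖) * (r ^ (m + 1) * ‖d (m + 1)‖)
        = r ^ (m + 1) * ((|((p + m + 1 : ℤ) : ℝ)| - ‖b‖) * ‖d (m + 1)‖) := by ring
      _ ≤ r ^ (m + 1) * ∑ j ∈ Finset.range (m + 1), ‖d (m - j)‖ * ‖a j‖ := by gcongr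
      _ = r * ∑ j ∈ Finset.range (m + 1), (r ^ (m - j) * ‖d (m - j)‖) * (r ^ j * ‖a j‖) := by
          rw [pow_succ', mul_assoc, Finset.mul_sum]
          congr 1
          refine Finset.sum_congr rfl fun j hj => ?_
          rw [← Nat.sub_add_cancel (Nat.lt_succ_iff.1 (Finset.mem_range.1 hj)), pow_add,
            Nat.add_sub_cancel]
          ring
      _ ≤ r * ∑ j ∈ Finset.range (m + 1), (r ^ (m - j) * ‖d (m - j)‖) * M := by
          gcongr with j
          exact hM j
      _ = r * M * S m := by
          rw [← Finset.sum_mul, hS]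
          have := Finset.sum_range_reflect (fun i => r ^ i * ‖d i‖) (m + 1)
          simp only [Nat.add_sub_cancel] at this ⊢
          rw [this]
          ring
  have hq0 : 0 < s / r := div_pos hs hr
  have hq1 : s / r < 1 := (div_lt_one hr).2 hsr
  set q := s / r
  have hM0 : 0 ≤ M := le_trans (by positivity) (hM 0)
  have hlam : Filter.Tendsto (fun m : ℕ => |((p + m + 1 : ℤ) : ℝ)| - ‖b‖)
      Filter.atTop Filter.atTop := by
    refine Filter.tendsto_atTop_mono (f := fun m : ℕ => (m : ℝ) + ((p : ℝ) + 1 - ‖b‖))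
      (fun m => ?_)
      (Filter.tendsto_atTop_add_const_right _ _ tendsto_natCast_atTop_atTop)
    have := le_abs_self ((p + m + 1 : ℤ) : ℝ)
    push_cast at this ⊢
    linarith
  have hsum : Summable fun m : ℕ => q ^ m * S m := by
    refine summable_of_ratio_norm_eventually_le (r := (1 + q) / 2) (by linarith) ?_
    filter_upwards [hlam.eventually_ge_atTop (r * M / ((1 - q) / 2)),
      hlam.eventually_ge_atTop 1] with m hm hm1
    rw [Real.norm_of_nonneg (mul_nonneg (by positivity) (hS0 _)),
      Real.norm_of_nonneg (mul_nonneg (by positivity) (hS0 _))]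
    rw [div_le_iff₀ (by linarith)] at hm
    set l := |((p + m + 1 : ℤ) : ℝ)| - ‖b‖
    have he : r ^ (m + 1) * ‖d (m + 1)‖ ≤ (1 - q) / 2 * S m := by
      have h2 : l * (r ^ (m + 1) * ‖d (m + 1)‖) ≤ l * ((1 - q) / 2 * S m) := by
        refine (key m).trans ?_
        rw [← mul_assoc]
        exact mul_le_mul_of_nonneg_right hm (hS0 m)
      exact le_of_mul_le_mul_left h2 (by linarith)
    have hS1 : S (m + 1) = S m + r ^ (m + 1) * ‖d (m + 1)‖ := Finset.sum_range_succ _ _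
    calc q ^ (m + 1) * S (m + 1) ≤ q ^ (m + 1) * (S m + (1 - q) / 2 * S m) := by
          rw [hS1]; gcongr
      _ = (q * (1 + (1 - q) / 2)) * (q ^ m * S m) := by ring
      _ ≤ (1 + q) / 2 * (q ^ m * S m) := by
          refine mul_le_mul_of_nonneg_right (by nlinarith) ?_
          exact mul_nonneg (by positivity) (hS0 m)
  obtain ⟨C, hC⟩ := hsum.tendsto_atTop_zero.bddAbove_range
  refine ⟨C, fun k => le_trans ?_ (hC ⟨k, rfl⟩)⟩
  have h3 : r ^ k * ‖d k‖ ≤ S k :=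
    Finset.single_le_sum (f := fun i => r ^ i * ‖d i‖) (fun i _ => by positivity)
      (Finset.self_mem_range_succ k)
  calc s ^ k * ‖d k‖ = q ^ k * (r ^ k * ‖d k‖) := by
        rw [← mul_assoc, ← mul_pow, div_mul_cancel₀ _ hr.ne']
    _ ≤ q ^ k * S k := by gcongr

theorem summable_norm_pow_smul {a : ℕ → 𝔸} {C t : ℝ} {z : ℂ} (hz : z ≠ 0) (hzt : ‖z‖ < t)
    (hC : ∀ k, t ^ k * ‖a k‖ ≤ C) : Summable fun k : ℕ => ‖z ^ k • a k‖ := by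
  simpa [norm_smul] using
    summable_pow_mul_geometric_mul_norm (norm_pos_iff.2 hz) hzt hC 0

variable [CompleteSpace 𝔸]

theorem hasDerivAt_tsum_pow_smul {d : ℕ → 𝔸} {C t : ℝ} {z : ℂ} (hz : z ≠ 0) (hzt : ‖z‖ < t)
    (hC : ∀ k, t ^ k * ‖d k‖ ≤ C) :
    HasDerivAt (fun w : ℂ => ∑' k : ℕ, w ^ k • d k)
      (∑' k : ℕ, ((k : ℂ) * z ^ (k - 1)) • d k) z := by
  obtain ⟨s, hzs, hst⟩ := exists_between hzt
  have hs : 0 < s := (norm_nonneg z).trans_lt hzs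
  have hu : Summable fun k : ℕ => (k : ℝ) * s ^ (k - 1) * ‖d k‖ := by
    refine ((summable_pow_mul_geometric_mul_norm hs hst hC 1).mul_right s⁻¹).congr fun k => ?_
    rcases k with _ | k
    · simp
    · rw [Nat.add_sub_cancel, pow_succ s]
      field_simp
  refine hasDerivAt_tsum_of_isPreconnected hu Metric.isOpen_ball
    (convex_ball (0 : ℂ) s).isPreconnected
    (g := fun (k : ℕ) (w : ℂ) => w ^ k • d k)
    (g' := fun (k : ℕ) (w : ℂ) => ((k : ℂ) * w ^ (k - 1)) • d k) (y₀ := z)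
    (fun k w _ => (hasDerivAt_pow k w).smul_const (d k)) (fun k w hw => ?_) ?_
    (summable_norm_pow_smul hz hzt hC).of_norm ?_
  · rw [norm_smul, norm_mul, norm_pow, Complex.norm_natCast]
    have : ‖w‖ ≤ s := (mem_ball_zero_iff.1 hw).le
    gcongr
  · exact mem_ball_zero_iff.2 hzs
  · exact mem_ball_zero_iff.2 hzs

/-- A formal Frobenius solution of `dY/dz = -Y A`, where `A` has at most a simple pole, converges
wherever `A` does and is a genuine solution. -/
theorem hasDerivAt_zpow_smul_tsum_of_recurrence {b : 𝔸} {a d : ℕ → 𝔸} {p : ℤ} {ρ : ℝ}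
    (ha : ∀ z : ℂ, z ≠ 0 → ‖z‖ < ρ → Summable fun k : ℕ => z ^ k • a k)
    (h0 : d 0 * ((p : ℂ) • (1 : 𝔸) + b) = 0)
    (hrec : ∀ m : ℕ, d (m + 1) * (((p + m + 1 : ℤ) : ℂ) • (1 : 𝔸) + b)
      = -∑ j ∈ Finset.range (m + 1), d (m - j) * a j)
    {z : ℂ} (hz : z ≠ 0) (hzρ : ‖z‖ < ρ) :
    (Summable fun k : ℕ => z ^ k • d k) ∧
    HasDerivAt (fun w : ℂ => w ^ p • ∑' k : ℕ, w ^ k • d k)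
      (-((z ^ p • ∑' k : ℕ, z ^ k • d k) * (z⁻¹ • b + ∑' k : ℕ, z ^ k • a k))) z := by
  obtain ⟨t, hzt, htρ⟩ := exists_between hzρ
  obtain ⟨r, htr, hrρ⟩ := exists_between htρ
  have ht : 0 < t := (norm_nonneg z).trans_lt hzt
  have hr : 0 < r := ht.trans htr
  obtain ⟨M, hM⟩ := exists_pow_mul_norm_le_of_summable hr.le
    (ha r (by exact_mod_cast hr.ne') (by simpa [abs_of_pos hr] using hrρ))
  obtain ⟨C, hC⟩ := exists_pow_mul_norm_le_of_recurrence ht htr hM hrec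
  have hsd := summable_norm_pow_smul hz hzt hC
  have hsa := summable_norm_pow_smul hz (hzt.trans htr) hM
  refine ⟨hsd.of_norm, ?_⟩
  have hder := (hasDerivAt_zpow p z (Or.inl hz)).smul (hasDerivAt_tsum_pow_smul hz hzt hC)
  refine hder.congr_deriv ?_
  set F := ∑' k : ℕ, z ^ k • d k with hF
  set G := ∑' k : ℕ, z ^ k • a k with hG
  set F' := ∑' k : ℕ, ((k : ℂ) * z ^ (k - 1)) • d k with hF'
  have hFG : F * G = ∑' m : ℕ, z ^ m • ∑ j ∈ Finset.range (m + 1), d (m - j) * a j := by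
    rw [hF, hG, tsum_mul_tsum_eq_tsum_sum_range_of_summable_norm hsd hsa]
    refine tsum_congr fun m => ?_
    rw [← Finset.sum_range_reflect, Finset.smul_sum]
    refine Finset.sum_congr rfl fun j hj => ?_
    have hj' : j ≤ m := Nat.lt_succ_iff.1 (Finset.mem_range.1 hj)
    rw [smul_mul_smul_comm, ← pow_add]
    congr 2
    · omega
    · congr 2; omega
  have hs1 : Summable fun k : ℕ => ((k : ℂ) * z ^ k) • d k := by
    refine Summable.of_norm ?_
    simpa [norm_smul] using
      summable_pow_mul_geometric_mul_norm (norm_pos_iff.2 hz) hzt hC 1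
  have hzF' : z • F' = ∑' k : ℕ, ((k : ℂ) * z ^ k) • d k := by
    rw [hF', ← tsum_const_smul'']
    refine tsum_congr fun k => ?_
    rcases k with _ | k
    · simp
    · rw [smul_smul, Nat.add_sub_cancel]
      congr 1
      ring
  have hs2 : Summable fun k : ℕ => z ^ k • (d k * (((p + k : ℤ) : ℂ) • (1 : 𝔸) + b)) := by
    refine (hs1.add ((hsd.of_norm.const_smul (p : ℂ)).add (hsd.of_norm.mul_right b))).congr
      fun k => ?_
    rw [mul_add, mul_smul_comm, mul_one, smul_mul_assoc]
    push_cast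
    module
  have hmain : z • F' + ((p : ℂ) • F + F * b) + z • (F * G) = 0 := by
    have h1 : z • F' + ((p : ℂ) • F + F * b)
        = ∑' k : ℕ, z ^ k • (d k * (((p + k : ℤ) : ℂ) • (1 : 𝔸) + b)) := by
      rw [hzF', hF, ← tsum_const_smul'', ← hsd.of_norm.tsum_mul_right,
        ← (hsd.of_norm.const_smul (p : ℂ)).tsum_add (hsd.of_norm.mul_right b),
        ← hs1.tsum_add ((hsd.of_norm.const_smul (p : ℂ)).add (hsd.of_norm.mul_right b))]
      refine tsum_congr fun k => ?_
      rw [mul_add, mul_smul_comm, mul_one, smul_mul_assoc]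
      push_cast
      module
    rw [h1, hs2.tsum_eq_zero_add, hFG, ← tsum_const_smul'']
    have h2 : ∀ k : ℕ, z ^ (k + 1) •
        (d (k + 1) * (((p + (k + 1 : ℕ) : ℤ) : ℂ) • (1 : 𝔸) + b))
        = -(z • z ^ k • ∑ j ∈ Finset.range (k + 1), d (k - j) * a j) := by
      intro k
      have := hrec k
      push_cast at this ⊢
      rw [← add_assoc, this, smul_neg, smul_smul, pow_succ']
    simp only [h2, tsum_neg]
    simp [h0]
  have hzp : z ^ p = z ^ (p - 1) * z := by
    rw [← zpow_add_one₀ hz, sub_add_cancel]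
  have hexp : z ^ p • F' + ((p : ℂ) * z ^ (p - 1)) • F + (z ^ p • F) * (z⁻¹ • b + G)
      = z ^ (p - 1) • (z • F' + ((p : ℂ) • F + F * b) + z • (F * G)) := by
    have h4 : z ^ p * z⁻¹ = z ^ (p - 1) := by rw [hzp, mul_assoc, mul_inv_cancel₀ hz, mul_one]
    rw [mul_add, smul_mul_smul_comm, h4, smul_mul_assoc, hzp]
    module
  rw [hmain, smul_zero] at hexp
  exact eq_neg_of_add_eq_zero_left hexp

end FrobeniusRecurrence

/-- Extension of an initial segment `c 0, …, c N` of Frobenius coefficients, where `u m` is the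
inverse of the factor by which the `m`-th coefficient is multiplied in the recurrence. -/
noncomputable def frobeniusExtend {R : Type*} [Ring R] (a c u : ℕ → R) (N : ℕ) : ℕ → R
  | 0 => c 0
  | m + 1 => if m + 1 ≤ N then c (m + 1) else
      -(∑ j : Fin (m + 1), frobeniusExtend a c u N (m - j) * a j) * u (m + 1)

theorem frobeniusExtend_of_le {R : Type*} [Ring R] (a c u : ℕ → R) {N m : ℕ} (h : m ≤ N) :
    frobeniusExtend a c u N m = c m := by
  cases m with
  | zero => rw [frobeniusExtend]
  | succ m => rw [frobeniusExtend, if_pos h]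

theorem frobeniusExtend_succ_of_lt {R : Type*} [Ring R] (a c u : ℕ → R) {N m : ℕ}
    (h : N < m + 1) : frobeniusExtend a c u N (m + 1) =
      -(∑ j ∈ Finset.range (m + 1), frobeniusExtend a c u N (m - j) * a j) * u (m + 1) := by
  rw [frobeniusExtend, if_neg (not_le.2 h),
    Finset.sum_range (fun j => frobeniusExtend a c u N (m - j) * a j)]

theorem isUnit_smul_one_add_of_forall_mulVec_ne {n : Type*} [Fintype n] [DecidableEq n]
    {B : Matrix n n ℂ} {z : ℂ} (h : ∀ v : n → ℂ, v ≠ 0 → B.mulVec v ≠ (-z) • v) :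
    IsUnit (z • (1 : Matrix n n ℂ) + B) := by
  rw [Matrix.isUnit_iff_isUnit_det, isUnit_iff_ne_zero]
  intro hdet
  obtain ⟨v, hv, hv0⟩ := Matrix.exists_mulVec_eq_zero_iff.2 hdet
  refine h v hv ?_
  rw [Matrix.add_mulVec, Matrix.smul_mulVec, Matrix.one_mulVec] at hv0
  rw [neg_smul]
  exact eq_neg_of_add_eq_zero_right hv0

section MatrixSystem

attribute [local instance] Matrix.linftyOpNormedRing Matrix.linftyOpNormedAlgebra

theorem matrix_hasDerivAt_zpow_smul_tsum_of_recurrence {n : Type*} [Fintype n] [DecidableEq n]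
    {b : Matrix n n ℂ} {a d : ℕ → Matrix n n ℂ} {p : ℤ} {ρ : ℝ}
    (ha : ∀ z : ℂ, z ≠ 0 → ‖z‖ < ρ → Summable fun k : ℕ => z ^ k • a k)
    (h0 : d 0 * ((p : ℂ) • (1 : Matrix n n ℂ) + b) = 0)
    (hrec : ∀ m : ℕ, d (m + 1) * (((p + m + 1 : ℤ) : ℂ) • (1 : Matrix n n ℂ) + b)
      = -∑ j ∈ Finset.range (m + 1), d (m - j) * a j)
    {z : ℂ} (hz : z ≠ 0) (hzρ : ‖z‖ < ρ) :
    (Summable fun k : ℕ => z ^ k • d k) ∧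
    ∀ i j, HasDerivAt (fun w : ℂ => (w ^ p • ∑' k : ℕ, w ^ k • d k) i j)
      ((-((z ^ p • ∑' k : ℕ, z ^ k • d k) * (z⁻¹ • b + ∑' k : ℕ, z ^ k • a k))) i j) z := by
  have hcomplete : CompleteSpace (Matrix n n ℂ) := FiniteDimensional.complete ℂ _
  obtain ⟨hs, hd⟩ := hasDerivAt_zpow_smul_tsum_of_recurrence ha h0 hrec hz hzρ
  refine ⟨hs, fun i j => ?_⟩
  exact (Matrix.entryLinearMap ℂ ℂ i j).toContinuousLinearMap.hasFDerivAt.comp_hasDerivAt z hd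

end MatrixSystem


/- STATEMENT 3: Let p ≤ P be integers with every integer eigenvalue of a₋₁ at least −P.
   If matrices c_p, …, c_P with c_p ≠ 0 satisfy
   c_{k+1}((k+1)Iₙ + a₋₁) = −Σ_{j=0}^{k−p} c_{k−j} a_j  (p−1 ≤ k ≤ P−1),
   then the adjoint system dY/dx = −Y A(x) has a solution
   Y(x) = Σ_{k≥p} c̃_k (x−x₀)^k on D with c̃_k = c_k for p ≤ k ≤ P and c̃_p = c_p ≠ 0. -/
theorem stmt_3 (n : ℕ) (hn : 1 ≤ n) (x₀ : ℂ) (ρ₀ : ℝ) (hρ₀ : 0 < ρ₀)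
    (D : Set ℂ) (hD : D = {x : ℂ | 0 < ‖x - x₀‖ ∧ ‖x - x₀‖ < ρ₀})
    (A : ℂ → Matrix (Fin n) (Fin n) ℂ)
    (aneg1 : Matrix (Fin n) (Fin n) ℂ) (a : ℕ → Matrix (Fin n) (Fin n) ℂ)
    -- A(x) = (x−x₀)⁻¹ • a₋₁ + Σ_{k≥0} a_k (x−x₀)^k, converging on D
    (hA : ∀ x ∈ D, HasSum (fun k : ℕ => ((x - x₀) ^ k) • a k)
      (A x - (x - x₀)⁻¹ • aneg1))
    (p P : ℤ) (hpP : p ≤ P)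
    -- every integer eigenvalue of a₋₁ is ≥ −P
    (hEig : ∀ k : ℤ, (∃ v : Fin n → ℂ, v ≠ 0 ∧ aneg1.mulVec v = (k : ℂ) • v) → -P ≤ k)
    (c : ℤ → Matrix (Fin n) (Fin n) ℂ) (hcp : c p ≠ 0)
    -- the recurrence (2.11) for p−1 ≤ k ≤ P−1 (empty right-hand sum when k = p−1)
    (hrec : ∀ k : ℤ, p - 1 ≤ k → k ≤ P - 1 →
      c (k + 1) * (((k : ℂ) + 1) • (1 : Matrix (Fin n) (Fin n) ℂ) + aneg1)
        = -∑ j ∈ Finset.range ((k - p + 1).toNat), c (k - (j : ℤ)) * a j) :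
    ∃ (Y : ℂ → Matrix (Fin n) (Fin n) ℂ) (ct : ℤ → Matrix (Fin n) (Fin n) ℂ),
      -- Y solves the adjoint system dY/dx = −Y A(x) on D
      (∀ x ∈ D, ∀ i j, HasDerivAt (fun y => Y y i j) ((-(Y x * A x)) i j) x) ∧
      -- Y(x) = Σ_{k≥p} c̃_k (x−x₀)^k on D
      (∀ x ∈ D, HasSum (fun k : ℕ => ((x - x₀) ^ (p + k : ℤ)) • ct (p + k)) (Y x)) ∧
      ct p ≠ 0 ∧
      (∀ k : ℤ, p ≤ k → k ≤ P → ct k = c k) := by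
  classical
  subst hD
  have hcast : ∀ k : ℕ, p + (k : ℤ) - p = k := fun k => by ring
  obtain ⟨N, rfl⟩ := Int.le.dest hpP
  set c' : ℕ → Matrix (Fin n) (Fin n) ℂ := fun m => c (p + m) with hc'
  set u : ℕ → Matrix (Fin n) (Fin n) ℂ :=
    fun m => Ring.inverse (((p + m : ℤ) : ℂ) • (1 : Matrix (Fin n) (Fin n) ℂ) + aneg1) with hu
  set d := frobeniusExtend a c' u N with hd
  have hd0 : d 0 = c p := by
    rw [hd, frobeniusExtend_of_le a c' u (Nat.zero_le N)]
    simp [hc']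
  have h0 : d 0 * ((p : ℂ) • (1 : Matrix (Fin n) (Fin n) ℂ) + aneg1) = 0 := by
    have := hrec (p - 1) le_rfl (by omega)
    simpa [hd0] using this
  have hdrec : ∀ m : ℕ, d (m + 1) *
      (((p + m + 1 : ℤ) : ℂ) • (1 : Matrix (Fin n) (Fin n) ℂ) + aneg1)
      = -∑ j ∈ Finset.range (m + 1), d (m - j) * a j := by
    intro m
    rcases le_or_gt (m + 1) N with hm | hm
    · have h := hrec (p + m) (by omega) (by omega)
      have hn : (p + (m : ℤ) - p + 1).toNat = m + 1 := by omega
      rw [hn] at h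
      rw [hd, frobeniusExtend_of_le a c' u hm]
      push_cast [hc'] at h ⊢
      rw [← add_assoc, h]
      congr 1
      refine Finset.sum_congr rfl fun j hj => ?_
      have hj' : j ≤ m := Nat.lt_succ_iff.1 (Finset.mem_range.1 hj)
      rw [frobeniusExtend_of_le a c' u (by omega : m - j ≤ N)]
      simp only [hc', Nat.cast_sub hj', add_sub_assoc]
    · have hunit : IsUnit (((p + (m + 1 : ℕ) : ℤ) : ℂ) •
          (1 : Matrix (Fin n) (Fin n) ℂ) + aneg1) := by
        refine isUnit_smul_one_add_of_forall_mulVec_ne fun v hv hv' => ?_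
        have := hEig (-(p + (m + 1 : ℕ))) ⟨v, hv, by rw [hv']; push_cast; rfl⟩
        omega
      have hcoe : p + (m : ℤ) + 1 = p + (m + 1 : ℕ) := by push_cast; ring
      rw [hcoe, hd, frobeniusExtend_succ_of_lt a c' u hm, mul_assoc]
      simp only [hu]
      rw [Ring.inverse_mul_cancel _ hunit, mul_one]
  have hmem : ∀ z : ℂ, z ≠ 0 → ‖z‖ < ρ₀ →
      z + x₀ ∈ {x : ℂ | 0 < ‖x - x₀‖ ∧ ‖x - x₀‖ < ρ₀} := fun z hz hzρ => by
    simpa using And.intro hz hzρ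
  have ha : ∀ z : ℂ, z ≠ 0 → ‖z‖ < ρ₀ → Summable fun k : ℕ => z ^ k • a k := by
    intro z hz hzρ
    simpa using (hA _ (hmem z hz hzρ)).summable
  refine ⟨fun x => (x - x₀) ^ p • ∑' k : ℕ, (x - x₀) ^ k • d k, fun k => d (k - p).toNat,
    ?_, ?_, ?_, ?_⟩
  · rintro x hx i j
    have h := (matrix_hasDerivAt_zpow_smul_tsum_of_recurrence ha h0 hdrec
      (norm_pos_iff.1 hx.1) hx.2).2 i j
    rw [(hA x hx).tsum_eq, add_sub_cancel] at h
    exact h.comp_sub_const x x₀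
  · rintro x hx
    have hx0 := norm_pos_iff.1 hx.1
    have h := (matrix_hasDerivAt_zpow_smul_tsum_of_recurrence ha h0 hdrec hx0 hx.2).1
    refine (h.hasSum.const_smul ((x - x₀) ^ p)).congr_fun fun k => ?_
    simp only [hcast, Int.toNat_natCast, smul_smul, zpow_add₀ hx0, zpow_natCast]
  · simpa [hd0] using hcp
  · intro k hpk hkP
    obtain ⟨m, rfl⟩ := Int.le.dest hpk
    simp only [hcast, Int.toNat_natCast]
    exact frobeniusExtend_of_le a c' u (by omega)
end

section
/- If the system dW/dx = A(x)W has a strong regular fundamental solution at x₀, then every eigenvalue of the matrix a₋₁ is an integer. -/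
open Topology Filter

/-- If the maps `b k` have no common kernel vector and `b k v` lies in the eigenspace of `T` for
`l k` as soon as `v` is killed by all earlier maps, then every eigenvalue of `T` is some `l k`. -/
lemma Module.End.HasEigenvalue.exists_eq_of_leading_eigenvectors {K V : Type*} [Field K]
    [AddCommGroup V] [Module K V] [FiniteDimensional K V] {T : Module.End K V}
    {b : ℕ → Module.End K V} {l : ℕ → K} (hl : Function.Injective l)
    (hb : ∀ k v, (∀ j < k, b j v = 0) → T (b k v) = l k • b k v)
    (h0 : ∀ v, (∀ k, b k v = 0) → v = 0) {μ : K} (hμ : T.HasEigenvalue μ) :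
    ∃ k, μ = l k := by
  by_contra! hne
  let U : ℕ → Submodule K V := fun k => ⨅ j ∈ Finset.range k, LinearMap.ker (b j)
  have hU : ∀ k v, v ∈ U k ↔ ∀ j < k, b j v = 0 := by
    intro k v
    simp [U, Submodule.mem_iInf]
  let F : ℕ → Submodule K V := fun k => ⨆ x ∈ l '' Set.Iio k, T.eigenspace x
  have hF : ∀ k, F (k + 1) = F k ⊔ T.eigenspace (l k) := by
    intro k
    have : l '' Set.Iio (k + 1) = insert (l k) (l '' Set.Iio k) := by
      rw [← Set.image_insert_eq]
      congr 1
      ext j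
      simp only [Set.mem_Iio, Set.mem_insert_iff]
      omega
    simp only [F, this, iSup_insert]
    rw [sup_comm]
  have hdim : ∀ k, Module.finrank K V ≤ Module.finrank K (U k) + Module.finrank K (F k) := by
    intro k
    induction k with
    | zero =>
      have : U 0 = ⊤ := by simp [U]
      rw [this, finrank_top]
      exact Nat.le_add_right _ _
    | succ k ih =>
      have hdis : Disjoint (F k) (T.eigenspace (l k)) := by
        refine (T.eigenspaces_iSupIndep.disjoint_biSup ?_).symm
        rintro ⟨j, hj, hjk⟩
        exact (Set.mem_Iio.1 hj).ne (hl hjk)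
      have hsum := Submodule.finrank_sup_add_finrank_inf_eq (F k) (T.eigenspace (l k))
      rw [hdis.eq_bot, finrank_bot, ← hF] at hsum
      have hrn := LinearMap.finrank_range_add_finrank_ker ((b k).domRestrict (U k))
      have hr : LinearMap.range ((b k).domRestrict (U k)) ≤ T.eigenspace (l k) := by
        rintro _ ⟨v, rfl⟩
        exact Module.End.mem_eigenspace_iff.2 (hb k v ((hU k v).1 v.2))
      have hker : (LinearMap.ker ((b k).domRestrict (U k))).map (U k).subtype ≤ U (k + 1) := by
        rintro _ ⟨v, hv, rfl⟩
        rw [hU]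
        intro j hj
        rcases Nat.lt_succ_iff_lt_or_eq.1 hj with h | rfl
        · exact (hU k v).1 v.2 j h
        · exact hv
      have h1 := Submodule.finrank_mono hr
      have h2 := Submodule.finrank_mono hker
      rw [Submodule.finrank_map_subtype_eq] at h2
      omega
  have hanti : Antitone U := fun i j hij v hv =>
    (hU i v).2 fun k hk => (hU j v).1 hv k (hk.trans_le hij)
  obtain ⟨N, hN⟩ := IsArtinian.monotone_stabilizes
    (⟨fun k => OrderDual.toDual (U k), fun _ _ h => hanti h⟩ : ℕ →o (Submodule K V)ᵒᵈ)
  have hN' : ∀ k, N ≤ k → U N = U k := hN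
  have hbot : U N = ⊥ := by
    rw [eq_bot_iff]
    intro v hv
    refine h0 v fun k => ?_
    have h1 : v ∈ U (max N (k + 1)) := hN' _ (le_max_left _ _) ▸ hv
    exact (hU _ v).1 h1 k (lt_of_lt_of_le k.lt_succ_self (le_max_right _ _))
  have htop : F N = ⊤ := by
    apply Submodule.eq_top_of_finrank_eq
    have h1 := hdim N
    rw [hbot, finrank_bot, zero_add] at h1
    exact le_antisymm (Submodule.finrank_le _) h1
  have hdis : Disjoint (T.eigenspace μ) (F N) := by
    refine T.eigenspaces_iSupIndep.disjoint_biSup ?_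
    rintro ⟨j, -, hj⟩
    exact hne j hj.symm
  rw [htop, disjoint_top] at hdis
  exact hμ hdis

/-- The sum of a power series converging on a punctured disc extends analytically to the
centre. -/
lemma exists_analyticAt_of_hasSum {f : ℂ → ℂ} {c : ℕ → ℂ} {x₀ : ℂ} {ρ : ℝ} (hρ : 0 < ρ)
    (h : ∀ x, 0 < ‖x - x₀‖ → ‖x - x₀‖ < ρ → HasSum (fun k => (x - x₀) ^ k * c k) (f x)) :
    ∃ g : ℂ → ℂ, AnalyticAt ℂ g x₀ ∧ g x₀ = c 0 ∧ ∀ x ≠ x₀, g x = f x := by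
  refine ⟨Function.update f x₀ (c 0), ?_, by simp, fun x hx => by simp [hx]⟩
  refine ⟨FormalMultilinearSeries.ofScalars ℂ c, hasFPowerSeriesAt_iff.2 ?_⟩
  filter_upwards [Metric.ball_mem_nhds (0 : ℂ) hρ] with z hz
  simp only [FormalMultilinearSeries.coeff_ofScalars, smul_eq_mul]
  by_cases hz0 : z = 0
  · subst hz0
    simpa using hasSum_single (f := fun k => (0 : ℂ) ^ k * c k) 0 fun k hk => by simp [hk]
  · have := h (x₀ + z) (by simpa using hz0) (by simpa using hz)
    simpa [hz0] using this

/-- The leading coefficient of a Laurent series solution of a linear system with a simple pole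
is an eigenvector of the residue matrix, for the leading exponent. -/
lemma mulVec_leading_coeff_eq_smul {n : ℕ} {x₀ : ℂ} {ρ : ℝ} (hρ : 0 < ρ)
    {A : ℂ → Matrix (Fin n) (Fin n) ℂ} {R : Matrix (Fin n) (Fin n) ℂ}
    {a : ℕ → Matrix (Fin n) (Fin n) ℂ}
    (hA : ∀ x, 0 < ‖x - x₀‖ → ‖x - x₀‖ < ρ →
      HasSum (fun k : ℕ => ((x - x₀) ^ k) • a k) (A x - (x - x₀)⁻¹ • R))
    {w : ℂ → Fin n → ℂ} {M : ℤ} {c : ℕ → Fin n → ℂ}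
    (hw : ∀ x, 0 < ‖x - x₀‖ → ‖x - x₀‖ < ρ →
      ∀ i, HasDerivAt (fun y => w y i) ((A x).mulVec (w x) i) x)
    (hc : ∀ x, 0 < ‖x - x₀‖ → ‖x - x₀‖ < ρ → ∀ i,
      HasSum (fun k : ℕ => (x - x₀) ^ (M + k : ℤ) * c k i) (w x i)) :
    R.mulVec (c 0) = (M : ℂ) • c 0 := by
  have hg : ∀ i, ∃ g : ℂ → ℂ, AnalyticAt ℂ g x₀ ∧ g x₀ = c 0 i ∧
      ∀ x ≠ x₀, g x = (x - x₀) ^ (-M) * w x i := by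
    intro i
    refine exists_analyticAt_of_hasSum (c := fun k => c k i) hρ fun x h1 h2 => ?_
    have hx : x - x₀ ≠ 0 := norm_pos_iff.1 h1
    refine ((hc x h1 h2 i).mul_left ((x - x₀) ^ (-M))).congr_fun fun k => ?_
    rw [← mul_assoc, ← zpow_add₀ hx, neg_add_cancel_left, zpow_natCast]
  choose g hga hg0 hgw using hg
  have hB : ∀ i j, ∃ B : ℂ → ℂ, AnalyticAt ℂ B x₀ ∧ B x₀ = a 0 i j ∧
      ∀ x ≠ x₀, B x = (A x - (x - x₀)⁻¹ • R) i j := by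
    intro i j
    refine exists_analyticAt_of_hasSum (c := fun k => a k i j) hρ fun x h1 h2 => ?_
    exact Pi.hasSum.1 (Pi.hasSum.1 (hA x h1 h2) i) j
  choose B hBa _ hBA using hB
  have hwg : ∀ i, ∀ x ≠ x₀, w x i = (x - x₀) ^ M * g i x := by
    intro i x hx
    rw [hgw i x hx, ← mul_assoc, ← zpow_add₀ (sub_ne_zero.2 hx), add_neg_cancel, zpow_zero,
      one_mul]
  ext i
  have hev : ∀ᶠ x in 𝓝[≠] x₀, ∑ j, R i j * g j x + (x - x₀) * ∑ j, B i j x * g j x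
      = M * g i x + (x - x₀) * deriv (g i) x := by
    have hball : ∀ᶠ x in 𝓝 x₀, ‖x - x₀‖ < ρ := by
      filter_upwards [Metric.ball_mem_nhds x₀ hρ] with x hx
      simpa [dist_eq_norm] using hx
    filter_upwards [nhdsWithin_le_nhds hball,
      nhdsWithin_le_nhds (hga i).eventually_analyticAt, self_mem_nhdsWithin] with x hxρ hgx hx
    have hx' : x ≠ x₀ := hx
    have ht : x - x₀ ≠ 0 := sub_ne_zero.2 hx'
    have h1 := hw x (norm_pos_iff.2 ht) hxρ i
    have h2 : HasDerivAt (fun y => (y - x₀) ^ M * g i y)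
        ((M * (x - x₀) ^ (M - 1)) * g i x + (x - x₀) ^ M * deriv (g i) x) x :=
      ((hasDerivAt_zpow M (x - x₀) (Or.inl ht)).comp_sub_const x x₀).mul
        hgx.differentiableAt.hasDerivAt
    have h3 : (fun y => w y i) =ᶠ[𝓝 x] fun y => (y - x₀) ^ M * g i y := by
      filter_upwards [isOpen_ne.mem_nhds hx'] with y hy using hwg i y hy
    have h4 := h1.unique (h2.congr_of_eventuallyEq h3)
    have h5 : (A x).mulVec (w x) i = (x - x₀) ^ (M - 1) *
        (∑ j, R i j * g j x + (x - x₀) * ∑ j, B i j x * g j x) := by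
      simp only [Matrix.mulVec, dotProduct, Finset.mul_sum, ← Finset.sum_add_distrib]
      refine Finset.sum_congr rfl fun j _ => ?_
      rw [hwg j x hx', hBA i j x hx', zpow_sub_one₀ ht]
      simp only [Matrix.sub_apply, Matrix.smul_apply, smul_eq_mul]
      field_simp
      ring
    rw [h5] at h4
    apply mul_left_cancel₀ (zpow_ne_zero (M - 1) ht)
    rw [h4, zpow_sub_one₀ ht]
    field_simp
  have hL : ContinuousAt (fun x => ∑ j, R i j * g j x + (x - x₀) * ∑ j, B i j x * g j x) x₀ := by
    have := fun j => (hga j).continuousAt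
    have := fun j => (hBa i j).continuousAt
    fun_prop
  have hR : ContinuousAt (fun x => M * g i x + (x - x₀) * deriv (g i) x) x₀ := by
    have := (hga i).continuousAt
    have := (hga i).deriv.continuousAt
    fun_prop
  have hlim := tendsto_nhds_unique_of_eventuallyEq
    (hL.tendsto.mono_left nhdsWithin_le_nhds) (hR.tendsto.mono_left nhdsWithin_le_nhds) hev
  simpa [hg0, Matrix.mulVec, dotProduct] using hlim


/- STATEMENT 5: If the system dW/dx = A(x)W has a strong regular fundamental solution
   at x₀ (a fundamental solution of form (2.2) for some integer leading order m),
   then every eigenvalue of a₋₁ is an integer. -/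
theorem stmt_5 (n : ℕ) (hn : 1 ≤ n) (x₀ : ℂ) (ρ₀ : ℝ) (hρ₀ : 0 < ρ₀)
    (D : Set ℂ) (hD : D = {x : ℂ | 0 < ‖x - x₀‖ ∧ ‖x - x₀‖ < ρ₀})
    (A : ℂ → Matrix (Fin n) (Fin n) ℂ)
    (aneg1 : Matrix (Fin n) (Fin n) ℂ) (a : ℕ → Matrix (Fin n) (Fin n) ℂ)
    -- A(x) = (x−x₀)⁻¹ • a₋₁ + Σ_{k≥0} a_k (x−x₀)^k, converging on D
    (hA : ∀ x ∈ D, HasSum (fun k : ℕ => ((x - x₀) ^ k) • a k)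
      (A x - (x - x₀)⁻¹ • aneg1))
    -- there is a strong regular fundamental solution at x₀
    (hexists : ∃ W : ℂ → Matrix (Fin n) (Fin n) ℂ,
      (∀ x ∈ D, ∀ i j, HasDerivAt (fun y => W y i j) ((A x * W x) i j) x) ∧
      (∀ x ∈ D, (W x).det ≠ 0) ∧
      (∃ (m : ℤ) (b : ℕ → Matrix (Fin n) (Fin n) ℂ), b 0 ≠ 0 ∧
        ∀ x ∈ D, HasSum (fun k : ℕ => ((x - x₀) ^ (m + k : ℤ)) • b k) (W x))) :
    ∀ μ : ℂ, (∃ v : Fin n → ℂ, v ≠ 0 ∧ aneg1.mulVec v = μ • v) → ∃ k : ℤ, μ = (k : ℂ) := by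
  rintro μ ⟨v, hv0, hv⟩
  obtain ⟨W, hW, hdet, m, b, -, hb⟩ := hexists
  have hsum : ∀ x ∈ D, ∀ u i,
      HasSum (fun k : ℕ => (x - x₀) ^ (m + k : ℤ) * (b k).mulVec u i) ((W x).mulVec u i) := by
    intro x hx u i
    simp only [Matrix.mulVec, dotProduct, Finset.mul_sum]
    refine hasSum_sum fun j _ => ?_
    simpa [mul_assoc] using (Pi.hasSum.1 (Pi.hasSum.1 (hb x hx) i) j).mul_right (u j)
  have hmem : ∀ x, 0 < ‖x - x₀‖ → ‖x - x₀‖ < ρ₀ → x ∈ D := fun x h1 h2 => by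
    rw [hD]
    exact ⟨h1, h2⟩
  have hμ : Module.End.HasEigenvalue (Matrix.toLin' aneg1) μ :=
    Module.End.hasEigenvalue_of_hasEigenvector (x := v)
      ⟨Module.End.mem_eigenspace_iff.2 (by simpa using hv), hv0⟩
  suffices h : ∃ k : ℕ, μ = ((m + k : ℤ) : ℂ) from h.imp' (fun k : ℕ => m + k) fun _ => id
  refine hμ.exists_eq_of_leading_eigenvectors (b := fun k => Matrix.toLin' (b k))
    (l := fun k => ((m + k : ℤ) : ℂ)) (fun i j hij => by simpa using hij) ?_ ?_
  · intro k u hu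
    simp only [Matrix.toLin'_apply] at hu ⊢
    have h := mulVec_leading_coeff_eq_smul (c := fun j => (b (j + k)).mulVec u)
      (w := fun x => (W x).mulVec u) (M := m + k) hρ₀ (fun x h1 h2 => hA x (hmem x h1 h2))
      ?_ ?_
    · simpa only [zero_add] using h
    · intro x h1 h2 i
      rw [Matrix.mulVec_mulVec]
      simp only [Matrix.mulVec, dotProduct]
      exact HasDerivAt.fun_sum fun j _ => (hW x (hmem x h1 h2) i j).mul_const (u j)
    · intro x h1 h2 i
      have h := (hasSum_nat_add_iff' k).2 (hsum x (hmem x h1 h2) u i)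
      rw [Finset.sum_eq_zero (fun j hj => by simp [hu j (Finset.mem_range.1 hj)]), sub_zero] at h
      refine h.congr_fun fun j => ?_
      push_cast
      rw [add_assoc, add_comm (k : ℤ)]
  · intro u hu
    have hx : x₀ + ((ρ₀ / 2 : ℝ) : ℂ) ∈ D := by
      apply hmem <;> rw [add_sub_cancel_left, Complex.norm_real, Real.norm_of_nonneg] <;> linarith
    refine Matrix.eq_zero_of_mulVec_eq_zero (hdet _ hx) ?_
    ext i
    refine (hsum _ hx u i).unique ?_
    simp only [Matrix.toLin'_apply] at hu
    simp [hu]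
end

section
/- Suppose a₋₁ ≠ 0 and the Katsnelson–Volok conditions hold: a₋₁² = −a₋₁ and a₋₁ a₀ a₋₁ = −a₀ a₋₁. Then the system dW/dx = A(x)W has a solution of form (2.2) with leading order m = −1 (a solution with exactly a simple pole at x₀, whose Laurent coefficient of index −1 is a₋₁ c for an invertible matrix c and whose coefficient of index 0 is a₀ a₋₁ c). -/
open Finset Filter

section PowerSeriesDerivative

variable {E : Type*} [NormedAddCommGroup E]

/-- Absolute convergence of a power series on a disc passes to its derived series. -/
theorem summable_nat_mul_norm_mul_pow {f : ℕ → E} {ρ : ℝ}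
    (hf : ∀ r, 0 < r → r < ρ → Summable fun k => ‖f k‖ * r ^ k) {r : ℝ} (hr : 0 < r)
    (hrρ : r < ρ) : Summable fun k : ℕ => (k : ℝ) * r ^ (k - 1) * ‖f k‖ := by
  obtain ⟨s, hrs, hsρ⟩ := exists_between hrρ
  have hs : 0 < s := hr.trans hrs
  obtain ⟨M, hM⟩ := (hf s hs hsρ).tendsto_atTop_zero.bddAbove_range
  have hgeom : Summable fun k : ℕ => (k : ℝ) ^ 1 * (r / s) ^ k :=
    summable_pow_mul_geometric_of_norm_lt_one 1 (by
      rw [Real.norm_of_nonneg (by positivity)]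
      exact (div_lt_one hs).2 hrs)
  refine Summable.of_nonneg_of_le (fun k => by positivity) (fun k => ?_) (hgeom.mul_left (M / r))
  have hk : ‖f k‖ * s ^ k ≤ M := hM ⟨k, rfl⟩
  rcases k with _ | k
  · simp
  · have : ((k + 1 : ℕ) : ℝ) * r ^ (k + 1 - 1) * ‖f (k + 1)‖
        = (‖f (k + 1)‖ * s ^ (k + 1)) / r * (((k + 1 : ℕ) : ℝ) ^ 1 * (r / s) ^ (k + 1)) := by
      rw [div_pow]
      field_simp
      simp only [add_tsub_cancel_right]
      ring
    rw [this]
    gcongr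

variable [NormedSpace ℂ E]

theorem summable_norm_pow_smul_s6 {f : ℕ → E} {t : ℂ} (hf : Summable fun k => ‖f k‖ * ‖t‖ ^ k) :
    Summable fun k => ‖t ^ k • f k‖ := by
  simpa only [norm_smul, norm_pow, mul_comm] using hf

variable [CompleteSpace E]

/-- A power series that converges absolutely on a disc can be differentiated termwise there. -/
theorem hasDerivAt_tsum_pow_smul_s6 {f : ℕ → E} {ρ : ℝ}
    (hf : ∀ r, 0 < r → r < ρ → Summable fun k => ‖f k‖ * r ^ k) {t : ℂ} (ht : ‖t‖ < ρ) :
    HasDerivAt (fun z : ℂ => ∑' k, z ^ k • f k)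
      (∑' k : ℕ, ((k : ℂ) * t ^ (k - 1)) • f k) t := by
  obtain ⟨r, htr, hrρ⟩ := exists_between ht
  have hr : 0 < r := (norm_nonneg t).trans_lt htr
  refine hasDerivAt_tsum_of_isPreconnected (summable_nat_mul_norm_mul_pow hf hr hrρ)
    Metric.isOpen_ball (convex_ball (0 : ℂ) r).isPreconnected
    (fun k y _ => (hasDerivAt_pow k y).smul_const (f k)) (fun k y hy => ?_)
    (Metric.mem_ball_self hr) ?_ (by simpa using htr)
  · rw [mem_ball_zero_iff] at hy
    rw [norm_smul, norm_mul, norm_pow, Complex.norm_natCast]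
    gcongr
  · exact summable_of_ne_finset_zero (s := {0}) fun k hk => by
      simp [zero_pow (by simpa using hk : k ≠ 0)]

end PowerSeriesDerivative

section Frobenius

variable {𝔸 : Type*} [NormedRing 𝔸] [NormedAlgebra ℂ 𝔸]

/-- The inverse of `s - p` when `p ^ 2 = -p` and `s ∉ {0, -1}`. -/
noncomputable def antiIdempotentResolvent (p : 𝔸) (s : ℂ) : 𝔸 :=
  s⁻¹ • (1 + (s + 1)⁻¹ • p)

theorem smul_antiIdempotentResolvent {p : 𝔸} (hp : p * p = -p) {s : ℂ} (hs : s ≠ 0)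
    (hs' : s + 1 ≠ 0) :
    s • antiIdempotentResolvent p s = p * antiIdempotentResolvent p s + 1 := by
  simp only [antiIdempotentResolvent, mul_smul_comm, mul_add, mul_one, hp]
  match_scalars <;> field_simp
  ring

theorem norm_antiIdempotentResolvent_le (p : 𝔸) (k : ℕ) :
    ‖antiIdempotentResolvent p ((k : ℂ) + 1)‖ ≤ (‖(1 : 𝔸)‖ + ‖p‖) / (k + 1) := by
  have h1 : ‖((k : ℂ) + 1)‖ = (k : ℝ) + 1 := by
    exact_mod_cast Complex.norm_natCast (k + 1)
  have h2 : ‖((k : ℂ) + 1 + 1)‖ = (k : ℝ) + 1 + 1 := by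
    exact_mod_cast Complex.norm_natCast (k + 1 + 1)
  rw [antiIdempotentResolvent, norm_smul, norm_inv, h1, div_eq_inv_mul]
  gcongr
  refine (norm_add_le _ _).trans ?_
  gcongr
  rw [norm_smul, norm_inv, h2]
  exact mul_le_of_le_one_left (norm_nonneg _) (inv_le_one_of_one_le₀ (by
    have : (0 : ℝ) ≤ k := k.cast_nonneg
    linarith))

/-- The coefficients of `x * W x` for the solution `W` with a simple pole at `0` of
`W' = (p / x + ∑ a k * x ^ k) * W` whose residue is `p`. -/
noncomputable def poleSolutionCoeff (p : 𝔸) (a : ℕ → 𝔸) : ℕ → 𝔸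
  | 0 => p
  | 1 => a 0 * p
  | k + 2 => antiIdempotentResolvent p ((k : ℂ) + 1) *
      ∑ j : Fin (k + 2), a j * poleSolutionCoeff p a (k + 1 - j)
  decreasing_by omega

theorem poleSolutionCoeff_zero (p : 𝔸) (a : ℕ → 𝔸) : poleSolutionCoeff p a 0 = p := by
  rw [poleSolutionCoeff]

theorem poleSolutionCoeff_one (p : 𝔸) (a : ℕ → 𝔸) : poleSolutionCoeff p a 1 = a 0 * p := by
  rw [poleSolutionCoeff]

theorem poleSolutionCoeff_add_two (p : 𝔸) (a : ℕ → 𝔸) (k : ℕ) :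
    poleSolutionCoeff p a (k + 2) = antiIdempotentResolvent p ((k : ℂ) + 1) *
      ∑ j ∈ range (k + 2), a j * poleSolutionCoeff p a (k + 1 - j) := by
  rw [poleSolutionCoeff, Finset.sum_range]

theorem poleSolutionCoeff_recurrence_zero {p : 𝔸} (hp : p * p = -p) (a : ℕ → 𝔸) :
    -poleSolutionCoeff p a 0 = p * poleSolutionCoeff p a 0 := by
  rw [poleSolutionCoeff_zero, hp]

theorem poleSolutionCoeff_recurrence_succ {p : 𝔸} {a : ℕ → 𝔸} (hp : p * p = -p)
    (hpa : p * a 0 * p = -(a 0 * p)) (k : ℕ) :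
    (k : ℂ) • poleSolutionCoeff p a (k + 1) = p * poleSolutionCoeff p a (k + 1) +
      ∑ j ∈ range (k + 1), a j * poleSolutionCoeff p a (k - j) := by
  rcases k with _ | k
  · simp [poleSolutionCoeff_zero, poleSolutionCoeff_one, ← mul_assoc, hpa]
  · have hs : (k : ℂ) + 1 ≠ 0 := by exact_mod_cast k.succ_ne_zero
    have hs' : (k : ℂ) + 1 + 1 ≠ 0 := by exact_mod_cast (k + 1).succ_ne_zero
    rw [poleSolutionCoeff_add_two, ← mul_assoc, ← smul_mul_assoc, Nat.cast_succ,
      smul_antiIdempotentResolvent hp hs hs', add_mul, one_mul]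

theorem summable_norm_poleSolutionCoeff (p : 𝔸) {a : ℕ → 𝔸} {ρ : ℝ}
    (ha : ∀ r, 0 < r → r < ρ → Summable fun k => ‖a k‖ * r ^ k) {r : ℝ} (hr : 0 < r)
    (hrρ : r < ρ) : Summable fun k => ‖poleSolutionCoeff p a k‖ * r ^ k := by
  obtain ⟨R, hrR, hRρ⟩ := exists_between hrρ
  have hR : 0 < R := hr.trans hrR
  obtain ⟨M, hM⟩ := (ha R hR hRρ).tendsto_atTop_zero.bddAbove_range
  replace hM : ∀ k, ‖a k‖ * R ^ k ≤ M := fun k => hM ⟨k, rfl⟩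
  have hM0 : 0 ≤ M := le_trans (by positivity) (hM 0)
  set b := poleSolutionCoeff p a
  set C := ‖(1 : 𝔸)‖ + ‖p‖
  have hC : 0 ≤ C := by positivity
  set S : ℕ → ℝ := fun k => ∑ j ∈ range k, ‖b j‖ * R ^ j
  have hS0 : ∀ k, 0 ≤ S k := fun k => sum_nonneg fun j _ => by positivity
  have hbS : ∀ k : ℕ, ‖b (k + 2)‖ * R ^ (k + 2) ≤ C * M * R / (k + 1) * S (k + 2) := by
    intro k
    have hsum : (∑ j ∈ range (k + 2), ‖a j‖ * ‖b (k + 1 - j)‖) * R ^ (k + 1)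
        ≤ M * S (k + 2) := by
      have hrefl : S (k + 2) = ∑ j ∈ range (k + 2), ‖b (k + 1 - j)‖ * R ^ (k + 1 - j) :=
        (sum_range_reflect (fun j => ‖b j‖ * R ^ j) (k + 2)).symm
      rw [hrefl, sum_mul, mul_sum]
      refine sum_le_sum fun j hj => ?_
      have hj' : j + (k + 1 - j) = k + 1 := by
        have := mem_range.1 hj
        omega
      calc ‖a j‖ * ‖b (k + 1 - j)‖ * R ^ (k + 1)
          = (‖a j‖ * R ^ j) * (‖b (k + 1 - j)‖ * R ^ (k + 1 - j)) := by
            conv_lhs => rw [← hj', pow_add, hj']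
            ring
        _ ≤ _ := by
            gcongr
            exact hM j
    calc ‖b (k + 2)‖ * R ^ (k + 2)
        ≤ (C / (k + 1) * ∑ j ∈ range (k + 2), ‖a j‖ * ‖b (k + 1 - j)‖) * R ^ (k + 2) := by
          gcongr
          rw [show b (k + 2) = _ from poleSolutionCoeff_add_two p a k]
          refine (norm_mul_le _ _).trans ?_
          gcongr
          · exact norm_antiIdempotentResolvent_le p k
          · exact (norm_sum_le _ _).trans (sum_le_sum fun j _ => norm_mul_le _ _)
      _ = C / (k + 1) * R *
          ((∑ j ∈ range (k + 2), ‖a j‖ * ‖b (k + 1 - j)‖) * R ^ (k + 1)) := by ring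
      _ ≤ C / (k + 1) * R * (M * S (k + 2)) := by gcongr
      _ = _ := by ring
  have hq : r / R < 1 := (div_lt_one hR).2 hrR
  obtain ⟨q, hrq, hq1⟩ := exists_between hq
  have hlim : Tendsto (fun k : ℕ => (1 + C * M * R / ((k : ℝ) + 1)) * (r / R)) atTop
      (nhds (r / R)) := by
    have h := tendsto_one_div_add_atTop_nhds_zero_nat (𝕜 := ℝ)
    simpa [mul_one_div, div_eq_mul_inv] using ((h.const_mul (C * M * R)).const_add 1).mul_const (r / R)
  have hSsum : Summable fun k => S (k + 2) * (r / R) ^ k := by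
    refine summable_of_ratio_norm_eventually_le hq1 ?_
    filter_upwards [hlim.eventually_lt_const hrq] with k hk
    have h1 := hS0 (k + 2)
    rw [Real.norm_of_nonneg (mul_nonneg (hS0 _) (by positivity)),
      Real.norm_of_nonneg (mul_nonneg (hS0 _) (by positivity))]
    have h2 : S (k + 1 + 2) ≤ (1 + C * M * R / (k + 1)) * S (k + 2) := by
      have := hbS k
      rw [show S (k + 1 + 2) = S (k + 2) + ‖b (k + 2)‖ * R ^ (k + 2) from sum_range_succ _ _]
      linarith
    calc S (k + 1 + 2) * (r / R) ^ (k + 1)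
        ≤ ((1 + C * M * R / (k + 1)) * S (k + 2)) * (r / R) ^ (k + 1) := by gcongr
      _ = ((1 + C * M * R / (k + 1)) * (r / R)) * (S (k + 2) * (r / R) ^ k) := by ring
      _ ≤ q * (S (k + 2) * (r / R) ^ k) := by gcongr
  refine Summable.of_nonneg_of_le (fun k => by positivity) (fun k => ?_) hSsum
  have h1 : ‖b k‖ * R ^ k ≤ S (k + 2) :=
    single_le_sum (f := fun j => ‖b j‖ * R ^ j) (fun j _ => by positivity)
      (mem_range.2 (by omega))
  calc ‖b k‖ * r ^ k = (‖b k‖ * R ^ k) * (r / R) ^ k := by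
        rw [div_pow]
        field_simp
    _ ≤ _ := by gcongr

variable [CompleteSpace 𝔸]

/-- The simple-pole solution of `W' = A W` when the residue `p` and the constant term `a 0` of `A`
satisfy the Katsnelson–Volok conditions. -/
theorem hasDerivAt_poleSolution {p : 𝔸} {a : ℕ → 𝔸} {ρ : ℝ} (hp : p * p = -p)
    (hpa : p * a 0 * p = -(a 0 * p))
    (ha : ∀ r, 0 < r → r < ρ → Summable fun k => ‖a k‖ * r ^ k) {t : ℂ} (ht0 : t ≠ 0)
    (ht : ‖t‖ < ρ) :
    HasDerivAt (fun z : ℂ => z⁻¹ • ∑' k, z ^ k • poleSolutionCoeff p a k)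
      ((t⁻¹ • p + ∑' k, t ^ k • a k) * (t⁻¹ • ∑' k, t ^ k • poleSolutionCoeff p a k)) t := by
  have htp : 0 < ‖t‖ := norm_pos_iff.2 ht0
  set b := poleSolutionCoeff p a
  have hb : ∀ r, 0 < r → r < ρ → Summable fun k => ‖b k‖ * r ^ k :=
    fun r hr hrρ => summable_norm_poleSolutionCoeff p ha hr hrρ
  have hasum := summable_norm_pow_smul_s6 (ha _ htp ht)
  have hbsum := summable_norm_pow_smul_s6 (hb _ htp ht)
  have hdsum : Summable fun k : ℕ => ((k : ℂ) * t ^ (k - 1)) • b k := by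
    refine Summable.of_norm ?_
    simpa only [norm_smul, norm_mul, norm_pow, Complex.norm_natCast] using
      summable_nat_mul_norm_mul_pow hb htp ht
  set H := ∑' k, t ^ k • b k with hH
  set H' := ∑' k : ℕ, ((k : ℂ) * t ^ (k - 1)) • b k with hH'
  have hcauchy : (∑' k, t ^ k • a k) * H
      = ∑' k, t ^ k • ∑ j ∈ range (k + 1), a j * b (k - j) := by
    rw [hH, tsum_mul_tsum_eq_tsum_sum_range_of_summable_norm hasum hbsum]
    refine tsum_congr fun k => ?_
    rw [smul_sum]
    refine sum_congr rfl fun j hj => ?_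
    rw [smul_mul_smul_comm, ← pow_add, Nat.add_sub_of_le (mem_range_succ_iff.1 hj)]
  have hprod : Summable fun k => t ^ k • ∑ j ∈ range (k + 1), a j * b (k - j) := by
    refine (summable_norm_sum_mul_range_of_summable_norm hasum hbsum).of_norm.congr fun k => ?_
    rw [smul_sum]
    refine sum_congr rfl fun j hj => ?_
    rw [smul_mul_smul_comm, ← pow_add, Nat.add_sub_of_le (mem_range_succ_iff.1 hj)]
  have hHsum : HasSum (fun k => t ^ k • b k) H := hbsum.of_norm.hasSum
  have hode : t • H' = H + p * H + t • ((∑' k, t ^ k • a k) * H) := by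
    have hl : HasSum (fun k : ℕ => t ^ k • (((k : ℂ) - 1) • b k - p * b k))
        (t • H' - H - p * H) := by
      refine (((hdsum.hasSum.const_smul t).sub hHsum).sub (hHsum.mul_left p)).congr_fun fun k => ?_
      rcases k with _ | k
      · simp [sub_eq_add_neg]
      · simp only [add_tsub_cancel_right, mul_smul_comm]
        match_scalars <;> ring
    have hr : HasSum (fun k : ℕ => t ^ k • (((k : ℂ) - 1) • b k - p * b k))
        (t • ((∑' k, t ^ k • a k) * H)) := by
      rw [← hasSum_nat_add_iff' 1, hcauchy]
      have h0 : -b 0 = p * b 0 := poleSolutionCoeff_recurrence_zero hp a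
      simp only [range_one, sum_singleton, Nat.cast_zero, zero_sub, neg_smul, one_smul, h0,
        sub_self, smul_zero, sub_zero]
      refine (hprod.hasSum.const_smul t).congr_fun fun k => ?_
      have hk := poleSolutionCoeff_recurrence_succ hp hpa k
      rw [Nat.cast_succ, add_sub_cancel_right, hk, add_sub_cancel_left, smul_smul, pow_succ']
    have := hl.unique hr
    rw [← this]
    abel
  have hder := (hasDerivAt_inv ht0).smul (hasDerivAt_tsum_pow_smul_s6 hb ht)
  refine hder.congr_deriv ?_
  change t⁻¹ • H' + (-(t ^ 2)⁻¹) • H = (t⁻¹ • p + ∑' k, t ^ k • a k) * (t⁻¹ • H)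
  have hH'eq : H' = t⁻¹ • (H + p * H + t • ((∑' k, t ^ k • a k) * H)) := by
    rw [← hode, inv_smul_smul₀ ht0]
  rw [hH'eq, add_mul, smul_mul_smul_comm, mul_smul_comm]
  match_scalars <;> field_simp
  ring

end Frobenius

section MatrixSystem

attribute [local instance] Matrix.linftyOpNormedRing Matrix.linftyOpNormedAlgebra

/-- Under the Katsnelson–Volok conditions, a linear system with a simple pole at `x₀` has a solution
with a simple pole there, whose residue is that of the system. -/
theorem exists_solution_simple_pole {n : ℕ} {x₀ : ℂ} {ρ : ℝ}
    {A : ℂ → Matrix (Fin n) (Fin n) ℂ} {p : Matrix (Fin n) (Fin n) ℂ}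
    {a : ℕ → Matrix (Fin n) (Fin n) ℂ}
    (hA : ∀ x, 0 < ‖x - x₀‖ → ‖x - x₀‖ < ρ →
      HasSum (fun k : ℕ => ((x - x₀) ^ k) • a k) (A x - (x - x₀)⁻¹ • p))
    (hp : p * p = -p) (hpa : p * a 0 * p = -(a 0 * p)) :
    ∃ (W : ℂ → Matrix (Fin n) (Fin n) ℂ) (b : ℕ → Matrix (Fin n) (Fin n) ℂ),
      (∀ x, 0 < ‖x - x₀‖ → ‖x - x₀‖ < ρ →
        (∀ i j, HasDerivAt (fun y => W y i j) ((A x * W x) i j) x) ∧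
        HasSum (fun k : ℕ => ((x - x₀) ^ ((-1 : ℤ) + k)) • b k) (W x)) ∧
      b 0 = p ∧ b 1 = a 0 * p := by
  have : CompleteSpace (Matrix (Fin n) (Fin n) ℂ) := FiniteDimensional.complete ℂ _
  have ha : ∀ r, 0 < r → r < ρ → Summable fun k => ‖a k‖ * r ^ k := by
    intro r hr hrρ
    have hnorm : ‖x₀ + r - x₀‖ = r := by simp [abs_of_pos hr]
    have h := (hA (x₀ + r) (by rwa [hnorm]) (by rwa [hnorm])).summable
    have h' := summable_norm_iff.2 h
    simpa only [norm_smul, norm_pow, hnorm, mul_comm] using h'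
  refine ⟨fun x => (x - x₀)⁻¹ • ∑' k, (x - x₀) ^ k • poleSolutionCoeff p a k,
    poleSolutionCoeff p a, fun x hx0 hxρ => ⟨fun i j => ?_, ?_⟩, poleSolutionCoeff_zero p a,
    poleSolutionCoeff_one p a⟩
  · have hAx : A x = (x - x₀)⁻¹ • p + ∑' k, (x - x₀) ^ k • a k := by
      rw [(hA x hx0 hxρ).tsum_eq]
      abel
    have h := (hasDerivAt_poleSolution hp hpa ha (norm_pos_iff.1 hx0) hxρ).comp_sub_const x x₀
    rw [hAx]
    exact hasDerivAt_pi.1 (hasDerivAt_pi.1 h i) j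
  · have hs := (summable_norm_pow_smul_s6
      (summable_norm_poleSolutionCoeff p ha hx0 hxρ)).of_norm.hasSum.const_smul (x - x₀)⁻¹
    refine hs.congr_fun fun k => ?_
    rw [zpow_add₀ (norm_pos_iff.1 hx0), zpow_neg_one, zpow_natCast, smul_smul]

end MatrixSystem


/- STATEMENT 6: Under the Katsnelson–Volok conditions a₋₁² = −a₋₁ and
   a₋₁a₀a₋₁ = −a₀a₋₁ (with a₋₁ ≠ 0), the system dW/dx = A(x)W has a solution of
   form (2.2) with leading order m = −1, whose Laurent coefficient of index −1 is
   a₋₁c for an invertible matrix c and whose coefficient of index 0 is a₀a₋₁c. -/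
theorem stmt_6 (n : ℕ) (hn : 1 ≤ n) (x₀ : ℂ) (ρ₀ : ℝ) (hρ₀ : 0 < ρ₀)
    (D : Set ℂ) (hD : D = {x : ℂ | 0 < ‖x - x₀‖ ∧ ‖x - x₀‖ < ρ₀})
    (A : ℂ → Matrix (Fin n) (Fin n) ℂ)
    (aneg1 : Matrix (Fin n) (Fin n) ℂ) (a : ℕ → Matrix (Fin n) (Fin n) ℂ)
    -- A(x) = (x−x₀)⁻¹ • a₋₁ + Σ_{k≥0} a_k (x−x₀)^k, converging on D
    (hA : ∀ x ∈ D, HasSum (fun k : ℕ => ((x - x₀) ^ k) • a k)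
      (A x - (x - x₀)⁻¹ • aneg1))
    (hne : aneg1 ≠ 0)
    -- the Katsnelson–Volok conditions (4.1)
    (hKV1 : aneg1 * aneg1 = -aneg1)
    (hKV2 : aneg1 * a 0 * aneg1 = -(a 0 * aneg1)) :
    ∃ (c : Matrix (Fin n) (Fin n) ℂ) (W : ℂ → Matrix (Fin n) (Fin n) ℂ)
      (b : ℕ → Matrix (Fin n) (Fin n) ℂ),
      IsUnit c ∧
      -- W solves dW/dx = A(x) W on D
      (∀ x ∈ D, ∀ i j, HasDerivAt (fun y => W y i j) ((A x * W x) i j) x) ∧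
      -- W has form (2.2) with leading order m = −1 (b k is the coefficient of index k−1)
      (∀ x ∈ D, HasSum (fun k : ℕ => ((x - x₀) ^ ((-1 : ℤ) + k)) • b k) (W x)) ∧
      b 0 ≠ 0 ∧ b 0 = aneg1 * c ∧ b 1 = a 0 * aneg1 * c := by
  subst hD
  obtain ⟨W, b, hW, hb0, hb1⟩ := exists_solution_simple_pole
    (fun x h0 h1 => hA x ⟨h0, h1⟩) hKV1 hKV2
  refine ⟨1, W, b, isUnit_one, fun x hx => (hW x hx.1 hx.2).1, fun x hx => (hW x hx.1 hx.2).2,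
    hb0 ▸ hne, ?_, ?_⟩
  · rw [hb0, mul_one]
  · rw [hb1, mul_one]
end

section
/- Assume in addition that α₀ = β₀. Then the system dW/dx = A(x)W has a strong regular fundamental solution at x₀ if and only if γ₋₁ = 0. -/
theorem hasDerivAt_tsum_pow_smul_s8 {E : Type*} [NormedAddCommGroup E] [NormedSpace ℂ E]
    [CompleteSpace E] {y : ℕ → E} {c : ℂ} {ρ : ℝ}
    (hy : ∀ s, 0 < s → s < ρ → ∃ C, ∀ n, ‖y n‖ * s ^ n ≤ C)
    {x : ℂ} (hx : x ∈ Metric.ball c ρ) :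
    Summable (fun n : ℕ => ‖(x - c) ^ n • y n‖) ∧
    Summable (fun n : ℕ => ((n : ℂ) * (x - c) ^ (n - 1)) • y n) ∧
    HasDerivAt (fun z => ∑' n : ℕ, (z - c) ^ n • y n)
      (∑' n : ℕ, ((n : ℂ) * (x - c) ^ (n - 1)) • y n) x := by
  rw [mem_ball_iff_norm] at hx
  obtain ⟨r, hxr, hrρ⟩ := exists_between hx
  obtain ⟨s, hrs, hsρ⟩ := exists_between hrρ
  have hr : 0 < r := (norm_nonneg _).trans_lt hxr
  have hs : 0 < s := hr.trans hrs
  obtain ⟨C, hC⟩ := hy s hs hsρ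
  have hq : ‖r / s‖ < 1 := by
    rw [Real.norm_of_nonneg (by positivity)]
    exact (div_lt_one hs).2 hrs
  have hyn : ∀ n, ‖y n‖ ≤ C / s ^ n := fun n => by
    rw [le_div_iff₀ (by positivity)]
    exact hC n
  have h0 : ∀ z ∈ Metric.ball c r, ∀ n : ℕ, ‖(z - c) ^ n • y n‖ ≤ C * (r / s) ^ n := by
    intro z hz n
    rw [mem_ball_iff_norm] at hz
    rw [norm_smul, norm_pow]
    calc ‖z - c‖ ^ n * ‖y n‖ ≤ r ^ n * (C / s ^ n) := by
          gcongr
          exact hyn n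
      _ = _ := by rw [div_pow]; ring
  have h1 : ∀ (n : ℕ) (z : ℂ), z ∈ Metric.ball c r →
      ‖((n : ℂ) * (z - c) ^ (n - 1)) • y n‖ ≤ C / r * ((n : ℝ) ^ 1 * (r / s) ^ n) := by
    intro n z hz
    rw [mem_ball_iff_norm] at hz
    rw [norm_smul, norm_mul, norm_pow, Complex.norm_natCast]
    rcases n with _ | n
    · simp
    · calc ((n + 1 : ℕ) : ℝ) * ‖z - c‖ ^ n * ‖y (n + 1)‖
          ≤ ((n + 1 : ℕ) : ℝ) * r ^ n * (C / s ^ (n + 1)) := by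
            gcongr
            exact hyn _
        _ = _ := by
            rw [div_pow, pow_succ r]
            field_simp
  have hs0 : Summable (fun n : ℕ => C * (r / s) ^ n) :=
    (summable_geometric_of_norm_lt_one hq).mul_left _
  have hs1 : Summable (fun n : ℕ => C / r * ((n : ℝ) ^ 1 * (r / s) ^ n)) :=
    (summable_pow_mul_geometric_of_norm_lt_one 1 hq).mul_left _
  have hxm : x ∈ Metric.ball c r := mem_ball_iff_norm.2 hxr
  have hsx : Summable (fun n : ℕ => ‖(x - c) ^ n • y n‖) :=
    Summable.of_nonneg_of_le (fun _ => norm_nonneg _) (h0 x hxm) hs0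
  refine ⟨hsx, Summable.of_norm_bounded hs1 (fun n => h1 n x hxm),
    hasDerivAt_tsum_of_isPreconnected hs1 Metric.isOpen_ball
      (convex_ball c r).isPreconnected ?_ h1 hxm hsx.of_norm hxm⟩
  intro n z _
  have := (((hasDerivAt_id z).sub_const c).pow n).smul_const (y n)
  simpa using this

/-- Taylor coefficients of the solution of `Y' = B Y`, `Y c = 1`, where `b` are those of `B`. -/
noncomputable def linearODECoeff {R : Type*} [Ring R] [Algebra ℂ R] (b : ℕ → R) : ℕ → R
  | 0 => 1
  | n + 1 => ((n : ℂ) + 1)⁻¹ • ∑ k : Fin (n + 1), b k * linearODECoeff b (n - k)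
  decreasing_by omega

theorem linearODECoeff_bounded {R : Type*} [NormedRing R] [NormedAlgebra ℂ R] {b : ℕ → R}
    {s : ℝ} (hs : 0 < s) (hb : Summable (fun n => ‖b n‖ * s ^ n)) :
    ∃ C, ∀ n, ‖linearODECoeff b n‖ * s ^ n ≤ C := by
  set S := ∑' n, ‖b n‖ * s ^ n
  obtain ⟨N, hN⟩ := exists_nat_ge (s * S)
  set C := ∑ k ∈ Finset.range (N + 1), ‖linearODECoeff b k‖ * s ^ k
  have hC : 0 ≤ C := Finset.sum_nonneg fun _ _ => by positivity
  refine ⟨C, fun n => ?_⟩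
  induction n using Nat.strong_induction_on with
  | _ n ih =>
    by_cases hn : n ≤ N
    · exact Finset.single_le_sum (f := fun k => ‖linearODECoeff b k‖ * s ^ k)
        (fun _ _ => by positivity) (Finset.mem_range.2 (by omega))
    · obtain ⟨m, rfl⟩ : ∃ m, n = m + 1 := ⟨n - 1, by omega⟩
      have hsum : ‖∑ k : Fin (m + 1), b k * linearODECoeff b (m - k)‖ * s ^ m ≤ S * C := by
        calc _ ≤ (∑ k : Fin (m + 1), ‖b k‖ * ‖linearODECoeff b (m - k)‖) * s ^ m := by
              gcongr
              exact norm_sum_le_of_le _ fun k _ => norm_mul_le _ _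
          _ = ∑ k : Fin (m + 1),
                (‖b k‖ * s ^ (k : ℕ)) * (‖linearODECoeff b (m - k)‖ * s ^ (m - k : ℕ)) := by
              rw [Finset.sum_mul]
              refine Finset.sum_congr rfl fun k _ => ?_
              have : s ^ m = s ^ (k : ℕ) * s ^ (m - k : ℕ) := by
                rw [← pow_add]; congr 1; omega
              rw [this]; ring
          _ ≤ ∑ k : Fin (m + 1), (‖b k‖ * s ^ (k : ℕ)) * C := by
              gcongr with k
              exact ih _ (by omega)
          _ = (∑ k ∈ Finset.range (m + 1), ‖b k‖ * s ^ k) * C := by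
              rw [← Finset.sum_mul, Finset.sum_range]
          _ ≤ S * C := by
              gcongr
              exact hb.sum_le_tsum _ fun _ _ => by positivity
      have hm : s * S ≤ (m : ℝ) + 1 :=
        hN.trans (by exact_mod_cast (by omega : N ≤ m + 1))
      have hnorm : ‖((m : ℂ) + 1)⁻¹‖ = ((m : ℝ) + 1)⁻¹ := by
        rw [norm_inv]
        congr 1
        exact_mod_cast Complex.norm_natCast (m + 1)
      rw [linearODECoeff, norm_smul, hnorm, pow_succ]
      calc _ = ((m : ℝ) + 1)⁻¹ * s *
            (‖∑ k : Fin (m + 1), b k * linearODECoeff b (m - k)‖ * s ^ m) := by ring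
        _ ≤ ((m : ℝ) + 1)⁻¹ * s * (S * C) := by gcongr
        _ = (s * S) / ((m : ℝ) + 1) * C := by ring
        _ ≤ 1 * C := by
            gcongr
            exact (div_le_one (by positivity)).2 hm
        _ = C := one_mul C

theorem exists_hasDerivAt_linearODE {R : Type*} [NormedRing R] [NormedAlgebra ℂ R]
    [FiniteDimensional ℂ R] {B : ℂ → R} {c : ℂ} {ρ : ℝ}
    (hB : DifferentiableOn ℂ B (Metric.ball c ρ)) :
    ∃ Y : ℂ → R, Y c = 1 ∧ ∀ x ∈ Metric.ball c ρ, HasDerivAt Y (B x * Y x) x := by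
  have : CompleteSpace R := FiniteDimensional.complete ℂ R
  have : FiniteDimensional ℝ R := FiniteDimensional.trans ℝ ℂ R
  set b : ℕ → R := fun n => (n.factorial : ℂ)⁻¹ • iteratedDeriv n B c
  have hsum : ∀ x ∈ Metric.ball c ρ, HasSum (fun n => (x - c) ^ n • b n) (B x) := by
    intro x hx
    simpa only [b, smul_smul, mul_comm] using Complex.hasSum_taylorSeries_on_ball hB hx
  have hbn : ∀ x ∈ Metric.ball c ρ, Summable (fun n => ‖(x - c) ^ n • b n‖) :=
    fun x hx => summable_norm_iff.2 (hsum x hx).summable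
  have hbd : ∀ s, 0 < s → s < ρ → ∃ C, ∀ n, ‖linearODECoeff b n‖ * s ^ n ≤ C := by
    intro s hs hsρ
    refine linearODECoeff_bounded hs ?_
    have := hbn (c + s) (by simpa [abs_of_pos hs] using hsρ)
    simpa [norm_smul, abs_of_pos hs, mul_comm] using this
  refine ⟨fun z => ∑' n : ℕ, (z - c) ^ n • linearODECoeff b n, ?_, fun x hx => ?_⟩
  · refine (tsum_eq_single 0 ?_).trans ?_
    swap
    · simp [linearODECoeff]
    · intro n hn
      simp [hn]
  · obtain ⟨h0, h1, h2⟩ := hasDerivAt_tsum_pow_smul_s8 hbd hx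
    refine h2.congr_deriv ?_
    rw [h1.tsum_eq_zero_add, ← (hsum x hx).tsum_eq,
      tsum_mul_tsum_eq_tsum_sum_range_of_summable_norm (hbn x hx) h0]
    simp only [Nat.cast_zero, zero_mul, zero_smul, zero_add]
    refine tsum_congr fun n => ?_
    have hn : (n : ℂ) + 1 ≠ 0 := Nat.cast_add_one_ne_zero n
    rw [linearODECoeff, smul_smul, Finset.sum_range, Finset.smul_sum]
    refine Finset.sum_congr rfl fun k _ => ?_
    have : (x - c) ^ n = (x - c) ^ (k : ℕ) * (x - c) ^ (n - k : ℕ) := by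
      rw [← pow_add]; congr 1; omega
    rw [smul_mul_smul_comm, ← this]
    congr 1
    push_cast
    field_simp

theorem eq_center_of_eq_punctured {f g : ℂ → ℂ} {c : ℂ} {ρ : ℝ} (hρ : 0 < ρ)
    (hf : ContinuousOn f (Metric.ball c ρ)) (hg : ContinuousOn g (Metric.ball c ρ))
    (h : ∀ x ∈ Metric.ball c ρ, x ≠ c → f x = g x) : f c = g c := by
  have hc : Metric.ball c ρ ∈ nhds c := Metric.ball_mem_nhds c hρ
  have h1 := (hf.continuousAt hc).tendsto.mono_left (nhdsWithin_le_nhds (s := {c}ᶜ))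
  have h2 := (hg.continuousAt hc).tendsto.mono_left (nhdsWithin_le_nhds (s := {c}ᶜ))
  refine tendsto_nhds_unique h1 (h2.congr' ?_)
  filter_upwards [self_mem_nhdsWithin, nhdsWithin_le_nhds hc] with x hx hx'
  exact (h x hx' hx).symm

/-- A solution of a scalar linear equation vanishes either identically or nowhere. -/
theorem eq_zero_iff_of_hasDerivAt_mul {f τ : ℂ → ℂ} {c : ℂ} {ρ : ℝ}
    (hτ : DifferentiableOn ℂ τ (Metric.ball c ρ)) (hf : DifferentiableOn ℂ f (Metric.ball c ρ))
    (hd : ∀ x ∈ Metric.ball c ρ, x ≠ c → HasDerivAt f (τ x * f x) x)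
    {x : ℂ} (hx : x ∈ Metric.ball c ρ) : f x = 0 ↔ f c = 0 := by
  have hρ : 0 < ρ := Metric.pos_of_mem_ball hx
  have hc : c ∈ Metric.ball c ρ := Metric.mem_ball_self hρ
  have hd' : ∀ z ∈ Metric.ball c ρ, HasDerivAt f (τ z * f z) z := by
    intro z hz
    by_cases hzc : z = c
    · subst hzc
      exact (hf.differentiableAt (Metric.ball_mem_nhds z hρ)).hasDerivAt.congr_deriv
        (eq_center_of_eq_punctured hρ (hf.deriv Metric.isOpen_ball).continuousOn
          (hτ.mul hf).continuousOn fun w hw hwc => (hd w hw hwc).deriv)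
    · exact hd z hz hzc
  obtain ⟨e, he, hed⟩ := exists_hasDerivAt_linearODE hτ
  obtain ⟨z, hz, hzd⟩ := exists_hasDerivAt_linearODE hτ.neg
  have key : ∀ g : ℂ → ℂ, (∀ w ∈ Metric.ball c ρ, HasDerivAt g (τ w * g w) w) →
      g x * z x = g c := by
    intro g hg
    have hgz : ∀ w ∈ Metric.ball c ρ, HasDerivAt (fun w => g w * z w) 0 w := fun w hw => by
      have := (hg w hw).mul (hzd w hw)
      convert! this using 1
      simp only [Pi.neg_apply]
      ring
    have := Metric.isOpen_ball.is_const_of_deriv_eq_zero (convex_ball c ρ).isPreconnected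
      (fun w hw => (hgz w hw).differentiableAt.differentiableWithinAt)
      (fun w hw => (hgz w hw).deriv) hx hc
    simpa [hz] using this
  have hzx : z x ≠ 0 := by
    intro h
    have := key e hed
    simp [h, he] at this
  rw [← key f hd', mul_eq_zero, or_iff_left hzx]

theorem exists_differentiableOn_of_hasSum_punctured {a : ℕ → ℂ} {f : ℂ → ℂ} {c : ℂ} {ρ : ℝ}
    (hf : ∀ x ∈ Metric.ball c ρ, x ≠ c → HasSum (fun k => a k * (x - c) ^ k) (f x)) :
    ∃ F : ℂ → ℂ, DifferentiableOn ℂ F (Metric.ball c ρ) ∧ F c = a 0 ∧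
      ∀ x ∈ Metric.ball c ρ, x ≠ c → F x = f x := by
  have hbd : ∀ s, 0 < s → s < ρ → ∃ C, ∀ n, ‖a n‖ * s ^ n ≤ C := by
    intro s hs hsρ
    have := (hf (c + s) (by simpa [abs_of_pos hs] using hsρ)
      (by simpa using hs.ne')).summable.norm
    refine ⟨_, fun n => le_trans (le_of_eq ?_) (this.le_tsum n fun _ _ => norm_nonneg _)⟩
    simp [abs_of_pos hs]
  refine ⟨fun z => ∑' n : ℕ, (z - c) ^ n • a n, fun x hx =>
    (hasDerivAt_tsum_pow_smul_s8 hbd hx).2.2.differentiableAt.differentiableWithinAt, ?_, ?_⟩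
  · refine (tsum_eq_single 0 fun n hn => ?_).trans ?_ <;> simp [*]
  · intro x hx hxc
    simpa only [smul_eq_mul, mul_comm] using (hf x hx hxc).tsum_eq

theorem exists_fundamental_pair {b₁₁ b₁₂ b₂₁ b₂₂ : ℂ → ℂ} {c : ℂ} {ρ : ℝ}
    (h₁₁ : DifferentiableOn ℂ b₁₁ (Metric.ball c ρ))
    (h₁₂ : DifferentiableOn ℂ b₁₂ (Metric.ball c ρ))
    (h₂₁ : DifferentiableOn ℂ b₂₁ (Metric.ball c ρ))
    (h₂₂ : DifferentiableOn ℂ b₂₂ (Metric.ball c ρ)) :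
    ∃ P Q : Fin 2 → ℂ → ℂ,
      (∀ j, ∀ x ∈ Metric.ball c ρ, HasDerivAt (P j) (b₁₁ x * P j x + b₁₂ x * Q j x) x) ∧
      (∀ j, ∀ x ∈ Metric.ball c ρ, HasDerivAt (Q j) (b₂₁ x * P j x + b₂₂ x * Q j x) x) ∧
      P 0 c * Q 1 c - P 1 c * Q 0 c = 1 := by
  let : NormedRing (Matrix (Fin 2) (Fin 2) ℂ) := Matrix.linftyOpNormedRing
  let : NormedAlgebra ℂ (Matrix (Fin 2) (Fin 2) ℂ) := Matrix.linftyOpNormedAlgebra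
  have hB : DifferentiableOn ℂ (fun x => b₁₁ x • (!![1, 0; 0, 0] : Matrix (Fin 2) (Fin 2) ℂ)
      + b₁₂ x • !![0, 1; 0, 0] + b₂₁ x • !![0, 0; 1, 0] + b₂₂ x • !![0, 0; 0, 1])
      (Metric.ball c ρ) :=
    (((h₁₁.smul_const _).add (h₁₂.smul_const _)).add (h₂₁.smul_const _)).add (h₂₂.smul_const _)
  obtain ⟨Y, hY, hd⟩ := exists_hasDerivAt_linearODE hB
  have hent : ∀ i j, ∀ x ∈ Metric.ball c ρ, HasDerivAt (fun z => Y z i j)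
      (((b₁₁ x • (!![1, 0; 0, 0] : Matrix (Fin 2) (Fin 2) ℂ) + b₁₂ x • !![0, 1; 0, 0]
        + b₂₁ x • !![0, 0; 1, 0] + b₂₂ x • !![0, 0; 0, 1]) * Y x :
        Matrix (Fin 2) (Fin 2) ℂ) i j) x := fun i j x hx =>
    (LinearMap.toContinuousLinearMap
      (Matrix.entryLinearMap ℂ ℂ i j)).hasFDerivAt.comp_hasDerivAt x (hd x hx)
  refine ⟨fun j z => Y z 0 j, fun j z => Y z 1 j, fun j x hx => ?_, fun j x hx => ?_, ?_⟩
  · refine (hent 0 j x hx).congr_deriv ?_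
    simp [Matrix.vecMul, dotProduct, Fin.sum_univ_two]
  · refine (hent 1 j x hx).congr_deriv ?_
    simp [Matrix.vecMul, dotProduct, Fin.sum_univ_two]
  · simp [hY]

/-- A solution, meromorphic at `c`, of a system with a nilpotent residue matrix `[[0, κ], [0, 0]]`
at `c` is holomorphic, and its second component vanishes at `c`. -/
theorem exists_holomorphic_extension_of_nilpotent_residue
    {b₁₁ b₁₂ b₂₁ b₂₂ R Q : ℂ → ℂ} {c κ : ℂ} {ρ : ℝ} (hρ : 0 < ρ) (hκ : κ ≠ 0)
    (h₁₁ : DifferentiableOn ℂ b₁₁ (Metric.ball c ρ))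
    (h₁₂ : DifferentiableOn ℂ b₁₂ (Metric.ball c ρ))
    (h₂₁ : DifferentiableOn ℂ b₂₁ (Metric.ball c ρ))
    (h₂₂ : DifferentiableOn ℂ b₂₂ (Metric.ball c ρ))
    (hR : ∀ x ∈ Metric.ball c ρ, x ≠ c →
      HasDerivAt R (b₁₁ x * R x + (κ / (x - c) + b₁₂ x) * Q x) x)
    (hQ : ∀ x ∈ Metric.ball c ρ, x ≠ c → HasDerivAt Q (b₂₁ x * R x + b₂₂ x * Q x) x)
    (n : ℕ) (u v : ℂ → ℂ) (hu : DifferentiableOn ℂ u (Metric.ball c ρ))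
    (hv : DifferentiableOn ℂ v (Metric.ball c ρ))
    (huR : ∀ x ∈ Metric.ball c ρ, x ≠ c → u x = (x - c) ^ n * R x)
    (hvQ : ∀ x ∈ Metric.ball c ρ, x ≠ c → v x = (x - c) ^ n * Q x) :
    ∃ U V : ℂ → ℂ, DifferentiableOn ℂ U (Metric.ball c ρ) ∧
      DifferentiableOn ℂ V (Metric.ball c ρ) ∧ V c = 0 ∧
      ∀ x ∈ Metric.ball c ρ, x ≠ c → U x = R x ∧ V x = Q x := by
  have hball : Metric.ball c ρ ∈ nhds c := Metric.ball_mem_nhds c hρ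
  have hder : ∀ {n : ℕ} {w S : ℂ → ℂ} {x s : ℂ}, x ∈ Metric.ball c ρ → x ≠ c →
      (∀ x ∈ Metric.ball c ρ, x ≠ c → w x = (x - c) ^ n * S x) → HasDerivAt S s x →
      (x - c) * deriv w x = n * w x + (x - c) ^ n * ((x - c) * s) := by
    intro n w S x s hx hxc hw hS
    have h1 : HasDerivAt w (n * (x - c) ^ (n - 1) * S x + (x - c) ^ n * s) x := by
      have h2 : HasDerivAt (fun z => (z - c) ^ n * S z) _ x :=
        (((hasDerivAt_id x).sub_const c).pow n).mul hS
      refine (h2.congr_of_eventuallyEq ?_).congr_deriv (by simp)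
      filter_upwards [Metric.isOpen_ball.mem_nhds hx, isOpen_ne.mem_nhds hxc] with z hz hzc
      exact hw z hz hzc
    rw [h1.deriv, hw x hx hxc]
    rcases n with _ | n
    · simp
    · rw [Nat.add_sub_cancel, pow_succ]
      ring
  induction n generalizing u v with
  | zero =>
    refine ⟨u, v, hu, hv, ?_, fun x hx hxc =>
      ⟨by simpa using huR x hx hxc, by simpa using hvQ x hx hxc⟩⟩
    have := eq_center_of_eq_punctured hρ
      (f := fun x => (x - c) * deriv u x)
      (g := fun x => (x - c) * b₁₁ x * u x + (κ + (x - c) * b₁₂ x) * v x)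
      (by have := (hu.deriv Metric.isOpen_ball).continuousOn; fun_prop)
      (by
        have := h₁₁.continuousOn; have := h₁₂.continuousOn
        have := hu.continuousOn; have := hv.continuousOn
        fun_prop)
      (fun x hx hxc => by
        have hxc' := sub_ne_zero.2 hxc
        rw [hder hx hxc huR (hR x hx hxc), huR x hx hxc, hvQ x hx hxc]
        field_simp
        simp)
    simpa [hκ] using this.symm
  | succ n ih =>
    have hn : (n : ℂ) + 1 ≠ 0 := Nat.cast_add_one_ne_zero n
    have hv0 : v c = 0 := by
      have := eq_center_of_eq_punctured hρ
        (f := fun x => (x - c) * deriv v x)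
        (g := fun x => (n + 1) * v x + (x - c) * (b₂₁ x * u x + b₂₂ x * v x))
        (by have := (hv.deriv Metric.isOpen_ball).continuousOn; fun_prop)
        (by
          have := h₂₁.continuousOn; have := h₂₂.continuousOn
          have := hu.continuousOn; have := hv.continuousOn
          fun_prop)
        (fun x hx hxc => by
          rw [hder hx hxc hvQ (hQ x hx hxc), huR x hx hxc, hvQ x hx hxc]
          push_cast
          ring)
      simpa [hn] using this.symm
    have hu0 : u c = 0 := by
      have := eq_center_of_eq_punctured hρ
        (f := fun x => (x - c) * deriv u x)
        (g := fun x => (n + 1) * u x + ((x - c) * b₁₁ x * u x + (κ + (x - c) * b₁₂ x) * v x))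
        (by have := (hu.deriv Metric.isOpen_ball).continuousOn; fun_prop)
        (by
          have := h₁₁.continuousOn; have := h₁₂.continuousOn
          have := hu.continuousOn; have := hv.continuousOn
          fun_prop)
        (fun x hx hxc => by
          have hxc' := sub_ne_zero.2 hxc
          rw [hder hx hxc huR (hR x hx hxc), huR x hx hxc, hvQ x hx hxc]
          push_cast
          field_simp)
      simpa [hn, hv0] using this.symm
    have hred : ∀ {w S : ℂ → ℂ}, w c = 0 →
        (∀ x ∈ Metric.ball c ρ, x ≠ c → w x = (x - c) ^ (n + 1) * S x) →
        ∀ x ∈ Metric.ball c ρ, x ≠ c → dslope w c x = (x - c) ^ n * S x := by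
      intro w S hw0 hw x hx hxc
      have h1 := sub_smul_dslope w c x
      rw [hw0, sub_zero, hw x hx hxc, smul_eq_mul, pow_succ', mul_assoc] at h1
      exact mul_left_cancel₀ (sub_ne_zero.2 hxc) h1
    exact ih (dslope u c) (dslope v c) ((Complex.differentiableOn_dslope hball).2 hu)
      ((Complex.differentiableOn_dslope hball).2 hv) (hred hu0 huR) (hred hv0 hvQ)

theorem stmt_8 (x₀ : ℂ) (ρ₀ : ℝ) (hρ₀ : 0 < ρ₀)
    (D : Set ℂ) (hD : D = {x : ℂ | 0 < ‖x - x₀‖ ∧ ‖x - x₀‖ < ρ₀})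
    (A : ℂ → Matrix (Fin 2) (Fin 2) ℂ)
    (α β γ μ : ℕ → ℂ) (γm2 γm1 : ℂ) (hγm2 : γm2 ≠ 0)
    -- a₁₁(x) = α₀ + α₁(x−x₀) + …
    (hA11 : ∀ x ∈ D, HasSum (fun k : ℕ => α k * (x - x₀) ^ k) (A x 0 0))
    -- a₂₂(x) = β₀ + β₁(x−x₀) + …
    (hA22 : ∀ x ∈ D, HasSum (fun k : ℕ => β k * (x - x₀) ^ k) (A x 1 1))
    -- a₁₂(x) = γ₋₂(x−x₀)⁻² + γ₋₁(x−x₀)⁻¹ + γ₀ + …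
    (hA12 : ∀ x ∈ D, HasSum (fun k : ℕ => γ k * (x - x₀) ^ k)
      (A x 0 1 - γm2 * ((x - x₀) ^ (-2 : ℤ)) - γm1 * (x - x₀)⁻¹))
    -- a₂₁(x) = μ₂(x−x₀)² + μ₃(x−x₀)³ + …
    (hA21 : ∀ x ∈ D, HasSum (fun k : ℕ => μ k * (x - x₀) ^ (k + 2)) (A x 1 0))
    -- additionally assume α₀ = β₀
    (hαβ : α 0 = β 0) :
    (∃ W : ℂ → Matrix (Fin 2) (Fin 2) ℂ,
      -- W solves dW/dx = A(x)W on D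
      (∀ x ∈ D, ∀ i j, HasDerivAt (fun y => W y i j) ((A x * W x) i j) x) ∧
      -- W is a fundamental solution
      (∀ x ∈ D, (W x).det ≠ 0) ∧
      -- strong regularity: (x−x₀)^{−m} W(x) extends holomorphically across x₀
      (∃ (m : ℤ) (V : ℂ → Matrix (Fin 2) (Fin 2) ℂ),
        (∀ i j, DifferentiableOn ℂ (fun x => V x i j) (Metric.ball x₀ ρ₀)) ∧
        ∀ x ∈ D, W x = ((x - x₀) ^ m) • V x)) ↔
    γm1 = 0 := by
  subst hD
  set D := {x : ℂ | 0 < ‖x - x₀‖ ∧ ‖x - x₀‖ < ρ₀} with hDdef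
  have hD : ∀ x, x ∈ Metric.ball x₀ ρ₀ → x ≠ x₀ → x ∈ D := fun x hx hxc =>
    ⟨norm_pos_iff.2 (sub_ne_zero.2 hxc), mem_ball_iff_norm.1 hx⟩
  have hDb : ∀ x ∈ D, x ∈ Metric.ball x₀ ρ₀ := fun x hx => mem_ball_iff_norm.2 hx.2
  have hDc : ∀ x ∈ D, x ≠ x₀ := fun x hx => sub_ne_zero.1 (norm_pos_iff.1 hx.1)
  have hball : Metric.ball x₀ ρ₀ ∈ nhds x₀ := Metric.ball_mem_nhds x₀ hρ₀
  obtain ⟨a, ha, ha0, haA⟩ := exists_differentiableOn_of_hasSum_punctured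
    fun x hx hxc => hA11 x (hD x hx hxc)
  obtain ⟨d, hd, hd0, hdA⟩ := exists_differentiableOn_of_hasSum_punctured
    fun x hx hxc => hA22 x (hD x hx hxc)
  obtain ⟨g, hg, -, hgA⟩ := exists_differentiableOn_of_hasSum_punctured
    fun x hx hxc => hA12 x (hD x hx hxc)
  obtain ⟨q, hq, -, hqA⟩ := exists_differentiableOn_of_hasSum_punctured
    (a := μ) (f := fun x => A x 1 0 / (x - x₀) ^ 2) (c := x₀) (ρ := ρ₀) fun x hx hxc => by
      have hxc' := sub_ne_zero.2 hxc
      refine ((hA21 x (hD x hx hxc)).div_const ((x - x₀) ^ 2)).congr_fun fun k => ?_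
      rw [pow_add]
      field_simp
  set e := dslope (fun x => d x - a x) x₀
  have he : DifferentiableOn ℂ e (Metric.ball x₀ ρ₀) :=
    (Complex.differentiableOn_dslope hball).2 (hd.sub ha)
  have hda : ∀ x, d x = a x + (x - x₀) * e x := fun x => by
    have := sub_smul_dslope (fun x => d x - a x) x₀ x
    rw [ha0, hd0, hαβ, sub_self, sub_zero, smul_eq_mul] at this
    rw [this]
    ring
  -- entries of the coefficient matrix after the gauge transformation `W₁ ↦ W₁ + γ₋₂ W₂ / (x - x₀)`
  set b₁₁ : ℂ → ℂ := fun x => a x + γm2 * (x - x₀) * q x with hb₁₁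
  set b₁₂ : ℂ → ℂ := fun x => g x + γm2 * e x - γm2 ^ 2 * q x with hb₁₂
  set b₂₁ : ℂ → ℂ := fun x => (x - x₀) ^ 2 * q x with hb₂₁
  set b₂₂ : ℂ → ℂ := fun x => d x - γm2 * (x - x₀) * q x with hb₂₂
  have h₁₁ : DifferentiableOn ℂ b₁₁ (Metric.ball x₀ ρ₀) := by fun_prop
  have h₁₂ : DifferentiableOn ℂ b₁₂ (Metric.ball x₀ ρ₀) := by fun_prop
  have h₂₁ : DifferentiableOn ℂ b₂₁ (Metric.ball x₀ ρ₀) := by fun_prop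
  have h₂₂ : DifferentiableOn ℂ b₂₂ (Metric.ball x₀ ρ₀) := by fun_prop
  have hA00 : ∀ x ∈ D, A x 0 0 = a x := fun x hx => (haA x (hDb x hx) (hDc x hx)).symm
  have hA11' : ∀ x ∈ D, A x 1 1 = a x + (x - x₀) * e x := fun x hx => by
    rw [← hdA x (hDb x hx) (hDc x hx), hda]
  have hA01 : ∀ x ∈ D, A x 0 1 = γm2 / (x - x₀) ^ 2 + γm1 / (x - x₀) + g x := fun x hx => by
    rw [hgA x (hDb x hx) (hDc x hx), zpow_neg]
    norm_cast
    ring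
  have hA10 : ∀ x ∈ D, A x 1 0 = (x - x₀) ^ 2 * q x := fun x hx => by
    have := sub_ne_zero.2 (hDc x hx)
    rw [hqA x (hDb x hx) (hDc x hx)]
    field_simp
  have hinv : ∀ x ∈ D, HasDerivAt (fun z => γm2 / (z - x₀)) (-γm2 / (x - x₀) ^ 2) x :=
    fun x hx => by
      exact ((hasDerivAt_const x γm2).div ((hasDerivAt_id x).sub_const x₀)
        (sub_ne_zero.2 (hDc x hx))).congr_deriv (by simp)
  constructor
  · rintro ⟨W, hW, hdet, m, V, hV, hWV⟩
    by_contra hγ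
    have hext : ∀ j, ∃ U Z : ℂ → ℂ, DifferentiableOn ℂ U (Metric.ball x₀ ρ₀) ∧
        DifferentiableOn ℂ Z (Metric.ball x₀ ρ₀) ∧ Z x₀ = 0 ∧
        ∀ x ∈ Metric.ball x₀ ρ₀, x ≠ x₀ →
          U x = W x 0 j + γm2 / (x - x₀) * W x 1 j ∧ Z x = W x 1 j := by
      intro j
      have hV0 := hV 0 j
      have hV1 := hV 1 j
      obtain ⟨k, hk⟩ : ∃ k : ℕ, (k : ℤ) = m.natAbs + m := ⟨(m.natAbs + m).toNat, by omega⟩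
      have hpow : ∀ x ∈ D, (x - x₀) ^ m.natAbs * (x - x₀) ^ m = (x - x₀) ^ k := fun x hx => by
        rw [← zpow_natCast _ k, hk, zpow_add₀ (sub_ne_zero.2 (hDc x hx)), zpow_natCast]
      refine exists_holomorphic_extension_of_nilpotent_residue hρ₀ hγ h₁₁ h₁₂ h₂₁ h₂₂
        (fun x hx hxc => ?_) (fun x hx hxc => ?_) (m.natAbs + 1)
        (fun x => (x - x₀) ^ k * ((x - x₀) * V x 0 j + γm2 * V x 1 j))
        (fun x => (x - x₀) ^ k * ((x - x₀) * V x 1 j)) (by fun_prop) (by fun_prop)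
        (fun x hx hxc => ?_) (fun x hx hxc => ?_)
      · have hxD := hD x hx hxc
        have hxc' := sub_ne_zero.2 hxc
        refine ((hW x hxD 0 j).add ((hinv x hxD).mul (hW x hxD 1 j))).congr_deriv ?_
        simp only [Matrix.mul_apply, Fin.sum_univ_two, hA00 x hxD, hA01 x hxD, hA10 x hxD,
          hA11' x hxD, hb₁₁, hb₁₂]
        field_simp
        ring
      · have hxD := hD x hx hxc
        have hxc' := sub_ne_zero.2 hxc
        refine (hW x hxD 1 j).congr_deriv ?_
        simp only [Matrix.mul_apply, Fin.sum_univ_two, hA10 x hxD, hA11' x hxD, hb₂₁, hb₂₂, hda]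
        field_simp
        ring
      · have hxD := hD x hx hxc
        have hxc' := sub_ne_zero.2 hxc
        rw [hWV x hxD, ← hpow x hxD, pow_succ]
        simp only [Matrix.smul_apply, smul_eq_mul]
        field_simp
      · have hxD := hD x hx hxc
        rw [hWV x hxD, ← hpow x hxD, pow_succ]
        simp only [Matrix.smul_apply, smul_eq_mul]
        ring
    choose U Z hU hZ hZ0 hUZ using hext
    have hU0 := hU 0
    have hU1 := hU 1
    have hZ0' := hZ 0
    have hZ1 := hZ 1
    have hUZdet : ∀ x ∈ D, U 0 x * Z 1 x - U 1 x * Z 0 x = (W x).det := fun x hx => by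
      have hxb := hDb x hx
      have hxc := hDc x hx
      rw [(hUZ 0 x hxb hxc).1, (hUZ 0 x hxb hxc).2, (hUZ 1 x hxb hxc).1, (hUZ 1 x hxb hxc).2,
        Matrix.det_fin_two]
      ring
    have hDopen : ∀ x ∈ D, D ∈ nhds x := fun x hx => by
      filter_upwards [Metric.isOpen_ball.mem_nhds (hDb x hx), isOpen_ne.mem_nhds (hDc x hx)]
        with z hz hzc using hD z hz hzc
    have hx₁ : x₀ + (ρ₀ / 2 : ℝ) ∈ D := by
      rw [hDdef, Set.mem_ofPred_eq, add_sub_cancel_left, Complex.norm_real,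
        Real.norm_of_nonneg (by positivity)]
      constructor <;> linarith
    refine hdet _ hx₁ ?_
    rw [← hUZdet _ hx₁]
    refine (eq_zero_iff_of_hasDerivAt_mul (f := fun x => U 0 x * Z 1 x - U 1 x * Z 0 x)
      (τ := fun x => a x + d x) (c := x₀) (ρ := ρ₀) (by fun_prop) (by fun_prop)
      (fun x hx hxc => ?_) (hDb _ hx₁)).2 (by simp [hZ0])
    have hxD := hD x hx hxc
    have hder : HasDerivAt (fun z => W z 0 0 * W z 1 1 - W z 0 1 * W z 1 0) _ x :=
      ((hW x hxD 0 0).mul (hW x hxD 1 1)).sub ((hW x hxD 0 1).mul (hW x hxD 1 0))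
    refine (hder.congr_of_eventuallyEq ?_).congr_deriv ?_
    · filter_upwards [hDopen x hxD] with z hz
      rw [hUZdet z hz, Matrix.det_fin_two]
    · simp only [Matrix.mul_apply, Fin.sum_univ_two, hUZdet x hxD, Matrix.det_fin_two,
        hA00 x hxD, hA11' x hxD, hda]
      ring
  · rintro rfl
    obtain ⟨P, Q, hP, hQ, hdet⟩ := exists_fundamental_pair h₁₁ h₁₂ h₂₁ h₂₂
    have hPd : ∀ j, DifferentiableOn ℂ (P j) (Metric.ball x₀ ρ₀) := fun j x hx =>
      (hP j x hx).differentiableAt.differentiableWithinAt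
    have hQd : ∀ j, DifferentiableOn ℂ (Q j) (Metric.ball x₀ ρ₀) := fun j x hx =>
      (hQ j x hx).differentiableAt.differentiableWithinAt
    have hdet' : ∀ x ∈ Metric.ball x₀ ρ₀, P 0 x * Q 1 x - P 1 x * Q 0 x ≠ 0 := by
      intro x hx h
      have hP0 := hPd 0
      have hP1 := hPd 1
      have hQ0 := hQd 0
      have hQ1 := hQd 1
      have := (eq_zero_iff_of_hasDerivAt_mul (f := fun x => P 0 x * Q 1 x - P 1 x * Q 0 x)
        (τ := fun x => b₁₁ x + b₂₂ x) (c := x₀) (ρ := ρ₀) (by fun_prop) (by fun_prop)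
        (fun x hx _ => ?_) hx).1 h
      · exact one_ne_zero (hdet.symm.trans this)
      · refine (((hP 0 x hx).mul (hQ 1 x hx)).sub ((hP 1 x hx).mul (hQ 0 x hx))).congr_deriv ?_
        ring
    refine ⟨fun x => Matrix.of ![fun j => P j x - γm2 / (x - x₀) * Q j x, fun j => Q j x],
      fun x hx i j => ?_, fun x hx => ?_, -1,
      fun x => Matrix.of ![fun j => (x - x₀) * P j x - γm2 * Q j x, fun j => (x - x₀) * Q j x],
      fun i j => ?_, fun x hx => ?_⟩
    · have hxb := hDb x hx
      have hxc := sub_ne_zero.2 (hDc x hx)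
      fin_cases i
      · refine ((hP j x hxb).sub ((hinv x hx).mul (hQ j x hxb))).congr_deriv ?_
        simp [Matrix.mul_apply, Fin.sum_univ_two, hA00 x hx, hA01 x hx,
          hb₁₁, hb₁₂, hb₂₁, hb₂₂, hda]
        field_simp
        ring
      · refine (hQ j x hxb).congr_deriv ?_
        simp [Matrix.mul_apply, Fin.sum_univ_two, hA10 x hx, hA11' x hx, hb₂₁, hb₂₂, hda]
        field_simp
        ring
    · rw [Matrix.det_fin_two]
      convert! hdet' x (hDb x hx) using 1
      simp
      ring
    · have hPj := hPd j
      have hQj := hQd j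
      fin_cases i
      · simp
        fun_prop
      · simp
        fun_prop
    · have hxc := sub_ne_zero.2 (hDc x hx)
      ext i j
      fin_cases i
      · simp
        field_simp
      · simp
        field_simp
end

section
/- Suppose that for every ρ ∈ ℂ the system dW/dx = (P(x) + ρQ(x))W has a strong regular fundamental solution at x₀. Then for every ρ ∈ ℂ all eigenvalues of the matrix p₋₁ + ρ q₋₁ are integers, and the set of eigenvalues of p₋₁ + ρ q₋₁ does not depend on ρ (it equals the set of eigenvalues of p₋₁). -/
open Filter Topology Polynomial

/-- A function given near `x₀` by a power series, except possibly at `x₀` itself, extends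
analytically. -/
theorem exists_analyticAt_eq_of_hasSum {E : Type*} [NormedAddCommGroup E] [NormedSpace ℂ E]
    {p : ℕ → E} {f : ℂ → E} {x₀ : ℂ}
    (h : ∀ᶠ x in 𝓝[≠] x₀, HasSum (fun k : ℕ => (x - x₀) ^ k • p k) (f x)) :
    ∃ g : ℂ → E, AnalyticAt ℂ g x₀ ∧ ∀ᶠ x in 𝓝[≠] x₀, f x = g x := by
  refine ⟨Function.update f x₀ (p 0), ?_, ?_⟩
  · let S : FormalMultilinearSeries ℂ ℂ E :=
      fun k => ContinuousMultilinearMap.mkPiRing ℂ (Fin k) (p k)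
    refine ⟨S, hasFPowerSeriesAt_iff'.2 ?_⟩
    filter_upwards [eventually_nhdsWithin_iff.1 h] with x hx
    simp only [S, FormalMultilinearSeries.coeff, ContinuousMultilinearMap.mkPiRing_apply,
      Pi.one_apply, Finset.prod_const_one, one_smul]
    by_cases hx0 : x = x₀
    · subst hx0
      simpa using hasSum_single (f := fun k : ℕ => (x - x) ^ k • p k) 0
        (fun k hk => by simp [hk])
    · simpa [hx0] using hx hx0
  · filter_upwards [self_mem_nhdsWithin] with x hx
    rw [Function.update_of_ne hx]

/-- If `(x - x₀) V' = B V`, then applying the descending factorial of the Euler operator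
`(x - x₀) d/dx` to `V` amounts to left multiplication by an analytic function whose value at `x₀`
is the descending factorial of `B x₀`, and the result vanishes to order `k` at `x₀`. -/
theorem exists_mul_eq_pow_smul_of_euler {R : Type*} [NormedRing R] [NormedAlgebra ℂ R]
    [CompleteSpace R] {x₀ : ℂ} {V B : ℂ → R} (hV : AnalyticAt ℂ V x₀) (hB : AnalyticAt ℂ B x₀)
    (h : ∀ᶠ x in 𝓝 x₀, (x - x₀) • deriv V x = B x * V x) (k : ℕ) :
    ∃ F G : ℂ → R, AnalyticAt ℂ F x₀ ∧ AnalyticAt ℂ G x₀ ∧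
      F x₀ = aeval (B x₀) (descPochhammer ℂ k) ∧
      ∀ᶠ x in 𝓝 x₀, F x * V x = (x - x₀) ^ k • G x := by
  induction k with
  | zero => exact ⟨fun _ => 1, V, analyticAt_const, hV, by simp, by simp⟩
  | succ k ih =>
    obtain ⟨F, G, hF, hG, hF0, hFG⟩ := ih
    refine ⟨fun x => (x - x₀) • deriv F x + F x * (B x - (k : R)), deriv G, ?_, hG.deriv, ?_, ?_⟩
    · exact ((analyticAt_id.sub analyticAt_const).smul hF.deriv).add
        (hF.mul (hB.sub analyticAt_const))
    · simp [descPochhammer_succ_right, hF0]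
    · have hd := Filter.EventuallyEq.deriv hFG
      filter_upwards [h, hFG, hd, hF.eventually_analyticAt, hG.eventually_analyticAt,
        hV.eventually_analyticAt] with x hx hx' hdx hFx hGx hVx
      have hL := (hFx.differentiableAt.hasDerivAt.mul hVx.differentiableAt.hasDerivAt).deriv
      have hR := (((hasDerivAt_id x).sub_const x₀).pow k |>.smul
        hGx.differentiableAt.hasDerivAt).deriv
      have e : deriv F x * V x + F x * deriv V x
          = (x - x₀) ^ k • deriv G x + (k * (x - x₀) ^ (k - 1)) • G x := by
        rw [← hL]
        refine hdx.trans (Eq.trans ?_ (hR.trans ?_))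
        · rfl
        · simp
      have hk : (x - x₀) * (k * (x - x₀) ^ (k - 1)) = k * (x - x₀) ^ k := by
        cases k with
        | zero => simp
        | succ k => simp [pow_succ]; ring
      calc ((x - x₀) • deriv F x + F x * (B x - (k : R))) * V x
          = (x - x₀) • (deriv F x * V x) + F x * (B x * V x) - (k : R) * (F x * V x) := by
            rw [add_mul, mul_sub, sub_mul, smul_mul_assoc, mul_assoc, ← Nat.cast_comm k (F x),
              mul_assoc]
            abel
        _ = (x - x₀) • (deriv F x * V x + F x * deriv V x) - (k : R) * (F x * V x) := by
            rw [← hx, mul_smul_comm, smul_add]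
        _ = (x - x₀) ^ (k + 1) • deriv G x := by
            rw [e, hx', smul_add, smul_smul, smul_smul, hk, mul_smul (k : ℂ),
              Nat.cast_smul_eq_nsmul, ← nsmul_eq_mul, ← pow_succ']
            abel

section

open scoped Matrix.Norms.Operator

variable {n : ℕ}

theorem hasDerivAt_matrix {V : ℂ → Matrix (Fin n) (Fin n) ℂ} {V' : Matrix (Fin n) (Fin n) ℂ} {x : ℂ}
    (h : ∀ i j, HasDerivAt (fun y => V y i j) (V' i j) x) : HasDerivAt V V' x := by
  have := HasDerivAt.fun_sum (u := Finset.univ) fun i _ =>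
    HasDerivAt.fun_sum (u := Finset.univ) fun j _ =>
      (h i j).smul_const (Matrix.single i j (1 : ℂ))
  simp only [Matrix.smul_single, smul_eq_mul, mul_one, ← Matrix.matrix_eq_sum_single] at this
  exact this

theorem analyticAt_matrix_det {V : ℂ → Matrix (Fin n) (Fin n) ℂ} {x₀ : ℂ}
    (h : ∀ i j, AnalyticAt ℂ (fun y => V y i j) x₀) : AnalyticAt ℂ (fun y => (V y).det) x₀ := by
  simp only [Matrix.det_apply']
  exact Finset.analyticAt_fun_sum _ fun σ _ => analyticAt_const.mul
    (Finset.analyticAt_fun_prod _ fun i _ => h _ _)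

/-- If `(x - x₀) V' = B V` has an analytic solution with `det V ≢ 0`, then some descending factorial
annihilates `B x₀`. -/
theorem exists_aeval_descPochhammer_eq_zero {V B : ℂ → Matrix (Fin n) (Fin n) ℂ} {x₀ : ℂ}
    (hV : AnalyticAt ℂ V x₀) (hdet : AnalyticAt ℂ (fun y => (V y).det) x₀)
    (hB : AnalyticAt ℂ B x₀)
    (h : ∀ᶠ x in 𝓝 x₀, (x - x₀) • deriv V x = B x * V x)
    (hne : ¬ ∀ᶠ x in 𝓝 x₀, (V x).det = 0) :
    ∃ k, aeval (B x₀) (descPochhammer ℂ k) = 0 := by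
  obtain ⟨s, g, hg, hg0, hgs⟩ := hdet.exists_eventuallyEq_pow_smul_nonzero_iff.2 hne
  obtain ⟨F, G, hF, hG, hF0, hFG⟩ := exists_mul_eq_pow_smul_of_euler hV hB h (s + 1)
  refine ⟨s + 1, ?_⟩
  rw [← hF0]
  have hadj : ContinuousAt (fun x => (V x).adjugate) x₀ :=
    (Continuous.matrix_adjugate continuous_id).continuousAt.comp hV.continuousAt
  have hEq : ∀ᶠ x in 𝓝[≠] x₀, g x • F x = (x - x₀) • (G x * (V x).adjugate) := by
    filter_upwards [nhdsWithin_le_nhds hgs, nhdsWithin_le_nhds hFG, self_mem_nhdsWithin]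
      with x h1 h2 hx
    have hz : (x - x₀) ^ s ≠ 0 := pow_ne_zero _ (sub_ne_zero.2 hx)
    apply smul_right_injective _ hz
    simp only
    rw [smul_smul, ← smul_eq_mul, ← h1, smul_smul, ← pow_succ, ← smul_mul_assoc, ← h2, mul_assoc,
      Matrix.mul_adjugate]
    simp
  have hl : ContinuousAt (fun x => g x • F x) x₀ := hg.continuousAt.smul hF.continuousAt
  have hr : ContinuousAt (fun x => (x - x₀) • (G x * (V x).adjugate)) x₀ :=
    (continuousAt_id.sub continuousAt_const).smul (hG.continuousAt.mul hadj)
  have := tendsto_nhds_unique ((hl.tendsto.mono_left nhdsWithin_le_nhds).congr' hEq)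
    (hr.tendsto.mono_left nhdsWithin_le_nhds)
  simpa [hg0] using this

/-- A system with a simple pole and a fundamental solution meromorphic at the pole has a residue
with integer eigenvalues. -/
theorem exists_int_of_mem_spectrum_residue {x₀ : ℂ} {r : ℝ} (hr : 0 < r)
    {D : Set ℂ} (hD : D = {x : ℂ | 0 < ‖x - x₀‖ ∧ ‖x - x₀‖ < r})
    {A W V : ℂ → Matrix (Fin n) (Fin n) ℂ} {R : Matrix (Fin n) (Fin n) ℂ}
    {a : ℕ → Matrix (Fin n) (Fin n) ℂ} {m : ℤ}
    (hA : ∀ x ∈ D, HasSum (fun k : ℕ => (x - x₀) ^ k • a k) (A x - (x - x₀)⁻¹ • R))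
    (hW : ∀ x ∈ D, ∀ i j, HasDerivAt (fun y => W y i j) ((A x * W x) i j) x)
    (hdet : ∀ x ∈ D, (W x).det ≠ 0)
    (hV : ∀ i j, DifferentiableOn ℂ (fun x => V x i j) (Metric.ball x₀ r))
    (hWV : ∀ x ∈ D, W x = (x - x₀) ^ m • V x)
    {μ : ℂ} (hμ : μ ∈ spectrum ℂ R) : ∃ k : ℤ, μ = k := by
  have hball : Metric.ball x₀ r ∈ 𝓝 x₀ := Metric.ball_mem_nhds _ hr
  have hDb : D = Metric.ball x₀ r ∩ {x₀}ᶜ := by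
    ext x
    simp [hD, dist_eq_norm, sub_eq_zero, and_comm]
  have hDo : IsOpen D := hDb ▸ Metric.isOpen_ball.inter isOpen_compl_singleton
  have hDn : ∀ᶠ x in 𝓝[≠] x₀, x ∈ D := by
    rw [hDb]
    exact inter_mem (nhdsWithin_le_nhds hball) self_mem_nhdsWithin
  obtain ⟨g, hg, hAg⟩ := exists_analyticAt_eq_of_hasSum (hDn.mono hA)
  have hVd : ∀ x ∈ Metric.ball x₀ r, DifferentiableAt ℂ V x := fun x hx =>
    (hasDerivAt_matrix (V' := Matrix.of fun i j => deriv (fun y => V y i j) x) fun i j =>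
      ((hV i j).differentiableAt (Metric.isOpen_ball.mem_nhds hx)).hasDerivAt).differentiableAt
  have hVa : AnalyticAt ℂ V x₀ :=
    DifferentiableOn.analyticAt (fun x hx => (hVd x hx).differentiableWithinAt) hball
  let B : ℂ → Matrix (Fin n) (Fin n) ℂ := fun x =>
    R - algebraMap ℂ _ (m : ℂ) + (x - x₀) • g x
  have hBa : AnalyticAt ℂ B x₀ :=
    analyticAt_const.add ((analyticAt_id.sub analyticAt_const).smul hg)
  have hODE : ∀ᶠ x in 𝓝[≠] x₀, (x - x₀) • deriv V x = B x * V x := by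
    filter_upwards [hDn, hAg] with x hx hgx
    have hxb : x ∈ Metric.ball x₀ r := (hDb ▸ hx : x ∈ Metric.ball x₀ r ∩ {x₀}ᶜ).1
    have hz : x - x₀ ≠ 0 := sub_ne_zero.2 (hDb ▸ hx : x ∈ Metric.ball x₀ r ∩ {x₀}ᶜ).2
    have h1 : HasDerivAt W (A x * W x) x := hasDerivAt_matrix (hW x hx)
    have hp : HasDerivAt (fun y => (y - x₀) ^ m) (m * (x - x₀) ^ (m - 1)) x := by
      simpa using (hasDerivAt_zpow m (x - x₀) (Or.inl hz)).comp_sub_const x x₀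
    have h2 := hp.smul (hVd x hxb).hasDerivAt
    have h3 := h2.congr_of_eventuallyEq
      (eventually_of_mem (hDo.mem_nhds hx) hWV)
    have h4 := h1.unique h3
    rw [hWV x hx] at h4
    have hzm : (x - x₀) ^ m ≠ 0 := zpow_ne_zero _ hz
    have hAx : A x = g x + (x - x₀)⁻¹ • R := by rw [← hgx]; abel
    apply smul_right_injective _ hzm
    simp only
    have h5 : (x - x₀) ^ m • (x - x₀) • deriv V x
        = (x - x₀) • (A x * (x - x₀) ^ m • V x) - (m * (x - x₀) ^ m) • V x := by
      rw [h4, smul_add, smul_smul, smul_smul, smul_smul, zpow_sub_one₀ hz]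
      rw [show (x - x₀) * (m * ((x - x₀) ^ m * (x - x₀)⁻¹)) = m * (x - x₀) ^ m by
        field_simp, mul_comm ((x - x₀) ^ m) (x - x₀)]
      abel
    rw [h5, hAx]
    simp only [B]
    generalize x - x₀ = z at *
    simp only [mul_smul_comm, add_mul, sub_mul, smul_add, smul_sub, smul_mul_assoc, smul_smul,
      ← Algebra.smul_def]
    rw [show z * (z ^ m * z⁻¹) = z ^ m by field_simp, mul_comm (m : ℂ), mul_comm z (z ^ m)]
    abel
  have hODE' : ∀ᶠ x in 𝓝 x₀, (x - x₀) • deriv V x = B x * V x :=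
    (AnalyticAt.frequently_eq_iff_eventually_eq
      ((analyticAt_id.sub analyticAt_const).smul hVa.deriv) (hBa.mul hVa)).1 hODE.frequently
  have hdV : AnalyticAt ℂ (fun y => (V y).det) x₀ :=
    analyticAt_matrix_det fun i j => (hV i j).analyticAt hball
  have hne : ¬ ∀ᶠ x in 𝓝 x₀, (V x).det = 0 := by
    intro h0
    obtain ⟨x, hx, hx0⟩ := (hDn.and (nhdsWithin_le_nhds h0)).exists
    apply hdet x hx
    rw [hWV x hx, Matrix.det_smul, hx0, mul_zero]
  obtain ⟨k, hk⟩ := exists_aeval_descPochhammer_eq_zero hVa hdV hBa hODE' hne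
  have hB0 : B x₀ = R - algebraMap ℂ _ (m : ℂ) := by simp [B]
  have hmem := spectrum.subset_polynomial_aeval R ((descPochhammer ℂ k).comp (X - C (m : ℂ)))
    ⟨μ, hμ, rfl⟩
  have hz : aeval R ((descPochhammer ℂ k).comp (X - C (m : ℂ))) = 0 := by
    rw [aeval_comp, map_sub, aeval_X, aeval_C, ← hB0, hk]
  rw [hz, spectrum.mem_iff, sub_zero] at hmem
  have he : (descPochhammer ℂ k).eval (μ - m) = 0 := by
    by_contra hne0
    apply hmem
    simpa using (IsUnit.mk0 _ hne0).map (algebraMap ℂ (Matrix (Fin n) (Fin n) ℂ))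
  rw [descPochhammer_eval_eq_prod_range, Finset.prod_eq_zero_iff] at he
  obtain ⟨j, -, hj⟩ := he
  exact ⟨m + j, by push_cast; linear_combination hj⟩

/-- A pencil of matrices all of whose eigenvalues are integers has constant spectrum. -/
theorem spectrum_add_smul_eq_of_int {A B : Matrix (Fin n) (Fin n) ℂ}
    (h : ∀ ρ : ℂ, ∀ μ ∈ spectrum ℂ (A + ρ • B), ∃ k : ℤ, μ = k) (ρ : ℂ) :
    spectrum ℂ (A + ρ • B) = spectrum ℂ A := by
  have key : ∀ (z : ℤ) (ρ : ℂ), (A + ρ • B).charpoly.eval (z : ℂ) = A.charpoly.eval (z : ℂ) := by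
    intro z ρ
    have hint : ∀ ρ : ℂ, (A + ρ • B).charpoly.eval (z : ℂ) ∈ Set.range ((↑) : ℤ → ℂ) := by
      intro ρ
      rw [(IsAlgClosed.splits _).eval_eq_prod_roots_of_monic (Matrix.charpoly_monic _)]
      change _ ∈ ((Int.castRingHom ℂ).range : Set ℂ)
      refine Subring.multiset_prod_mem _ _ fun c hc => ?_
      obtain ⟨μ, hμ, rfl⟩ := Multiset.mem_map.1 hc
      obtain ⟨k, rfl⟩ := h ρ μ (Matrix.mem_spectrum_of_isRoot_charpoly (isRoot_of_mem_roots hμ))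
      exact ⟨z - k, by simp⟩
    have hcont : Continuous fun ρ : ℂ => (A + ρ • B).charpoly.eval (z : ℂ) := by
      simp only [Matrix.eval_charpoly]
      fun_prop
    have := isPreconnected_univ.constant_of_mapsTo
      Complex.isClosedEmbedding_intCast.isInducing.isDiscrete_range hcont.continuousOn
      (fun ρ _ => hint ρ) (Set.mem_univ ρ) (Set.mem_univ 0)
    simpa using this
  have h0 : ∀ μ ∈ spectrum ℂ A, ∃ k : ℤ, μ = k := fun μ hμ => h 0 μ (by simpa using hμ)
  ext μ
  constructor
  · intro hμ
    obtain ⟨k, rfl⟩ := h ρ μ hμ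
    rw [Matrix.mem_spectrum_iff_isRoot_charpoly, IsRoot.def] at hμ ⊢
    rwa [← key k ρ]
  · intro hμ
    obtain ⟨k, rfl⟩ := h0 μ hμ
    rw [Matrix.mem_spectrum_iff_isRoot_charpoly, IsRoot.def] at hμ ⊢
    rwa [key k ρ]

theorem exists_mulVec_eq_smul_iff_mem_spectrum {A : Matrix (Fin n) (Fin n) ℂ} {μ : ℂ} :
    (∃ v : Fin n → ℂ, v ≠ 0 ∧ A.mulVec v = μ • v) ↔ μ ∈ spectrum ℂ A := by
  rw [Matrix.mem_spectrum_iff_isRoot_charpoly, IsRoot.def, Matrix.eval_charpoly,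
    ← Matrix.exists_mulVec_eq_zero_iff]
  simp [Matrix.sub_mulVec, sub_eq_zero, eq_comm]

end


/- STATEMENT 9: If for every ρ ∈ ℂ the system dW/dx = (P(x) + ρQ(x))W (where P and Q
   have at worst simple poles at x₀) has a strong regular fundamental solution at x₀,
   then for every ρ all eigenvalues of p₋₁ + ρq₋₁ are integers and the set of
   eigenvalues of p₋₁ + ρq₋₁ does not depend on ρ (it equals that of p₋₁). -/
theorem stmt_9 (n : ℕ) (hn : 1 ≤ n) (x₀ : ℂ) (ρ₀ : ℝ) (hρ₀ : 0 < ρ₀)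
    (D : Set ℂ) (hD : D = {x : ℂ | 0 < ‖x - x₀‖ ∧ ‖x - x₀‖ < ρ₀})
    (P Q : ℂ → Matrix (Fin n) (Fin n) ℂ)
    (pneg1 qneg1 : Matrix (Fin n) (Fin n) ℂ) (p q : ℕ → Matrix (Fin n) (Fin n) ℂ)
    -- P(x) = (x−x₀)⁻¹ • p₋₁ + Σ_{k≥0} p_k (x−x₀)^k on D
    (hP : ∀ x ∈ D, HasSum (fun k : ℕ => ((x - x₀) ^ k) • p k)
      (P x - (x - x₀)⁻¹ • pneg1))
    -- Q(x) = (x−x₀)⁻¹ • q₋₁ + Σ_{k≥0} q_k (x−x₀)^k on D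
    (hQ : ∀ x ∈ D, HasSum (fun k : ℕ => ((x - x₀) ^ k) • q k)
      (Q x - (x - x₀)⁻¹ • qneg1))
    -- for every ρ there is a strong regular fundamental solution at x₀
    (hsol : ∀ ρ : ℂ, ∃ W : ℂ → Matrix (Fin n) (Fin n) ℂ,
      (∀ x ∈ D, ∀ i j, HasDerivAt (fun y => W y i j) (((P x + ρ • Q x) * W x) i j) x) ∧
      (∀ x ∈ D, (W x).det ≠ 0) ∧
      (∃ (m : ℤ) (V : ℂ → Matrix (Fin n) (Fin n) ℂ),
        (∀ i j, DifferentiableOn ℂ (fun x => V x i j) (Metric.ball x₀ ρ₀)) ∧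
        ∀ x ∈ D, W x = ((x - x₀) ^ m) • V x)) :
    ∀ ρ : ℂ,
      (∀ μ : ℂ, (∃ v : Fin n → ℂ, v ≠ 0 ∧ (pneg1 + ρ • qneg1).mulVec v = μ • v) →
        ∃ k : ℤ, μ = (k : ℂ)) ∧
      {μ : ℂ | ∃ v : Fin n → ℂ, v ≠ 0 ∧ (pneg1 + ρ • qneg1).mulVec v = μ • v}
        = {μ : ℂ | ∃ v : Fin n → ℂ, v ≠ 0 ∧ pneg1.mulVec v = μ • v} := by
  have hsp : ∀ ρ : ℂ, ∀ μ ∈ spectrum ℂ (pneg1 + ρ • qneg1), ∃ k : ℤ, μ = k := by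
    intro ρ μ hμ
    obtain ⟨W, hW, hdet, m, V, hV, hWV⟩ := hsol ρ
    refine exists_int_of_mem_spectrum_residue (A := fun x => P x + ρ • Q x)
      (a := fun k => p k + ρ • q k) hρ₀ hD (fun x hx => ?_) hW hdet hV hWV hμ
    convert (hP x hx).add ((hQ x hx).const_smul ρ) using 1
    · ext k : 1
      rw [smul_add, smul_comm ρ]
    · rw [smul_sub, smul_add, smul_comm ρ]
      abel
  intro ρ
  simp only [exists_mulVec_eq_smul_iff_mem_spectrum]
  exact ⟨hsp ρ, spectrum_add_smul_eq_of_int hsp ρ⟩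
end
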